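/- arXiv:1107.1052 — 3 statements merged into one kernel-verified Lean document; each statement's English description precedes it below -/
import Mathlib

section
/- Every bridgeless cubic graph can be partitioned into a perfect matching and a cycle cover; that is, its edge set is the disjoint union of a perfect matching and a 2-regular spanning subgraph. -/
/-- Darts leaving an odd vertex set in a bridgeless cubic graph: at least three. -/
theorem three_le_cut {V : Type} [Fintype V] (G : SimpleGraph V) [DecidableEq V]
    [DecidableRel G.Adj]
    (hcubic : ∀ v : V, (G.neighborSet v).ncard = 3)
    (hbridgeless : ∀ e ∈ G.edgeSet, ¬ G.IsBridge e) (S : Finset V) (hS : Odd S.card) :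
    3 ≤ (Finset.univ.filter
      (fun p : V × V => p.1 ∈ S ∧ p.2 ∉ S ∧ G.Adj p.1 p.2)).card := by
  set D := Finset.univ.filter (fun p : V × V => p.1 ∈ S ∧ p.2 ∉ S ∧ G.Adj p.1 p.2) with hD
  set I := Finset.univ.filter (fun p : V × V => p.1 ∈ S ∧ p.2 ∈ S ∧ G.Adj p.1 p.2) with hI
  set T := Finset.univ.filter (fun p : V × V => p.1 ∈ S ∧ G.Adj p.1 p.2) with hT
  have hIeven : Even I.card := by
    rw [← ZMod.natCast_eq_zero_iff_even, Finset.card_eq_sum_ones, Nat.cast_sum]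
    refine Finset.sum_involution (fun p _ => p.swap) ?_ ?_ ?_ ?_
    · intro a _
      decide
    · rintro ⟨a, b⟩ h _ heq
      simp only [hI, Finset.mem_filter] at h
      simp only [Prod.swap_prod_mk, Prod.mk.injEq] at heq
      exact h.2.2.2.ne heq.2
    · rintro ⟨a, b⟩ h
      simp only [hI, Finset.mem_filter, Finset.mem_univ, true_and, Prod.swap_prod_mk] at h ⊢
      exact ⟨h.2.1, h.1, h.2.2.symm⟩
    · simp
  have hTcard : T.card = S.card * 3 := by
    rw [Finset.card_eq_sum_card_fiberwise (f := Prod.fst) (t := S)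
      (by intro p hp; simp only [hT, Finset.coe_filter, Set.mem_setOf_eq] at hp; exact hp.2.1)]
    rw [Finset.sum_const_nat]
    intro a ha
    rw [← hcubic a, Set.ncard_eq_toFinset_card']
    refine Finset.card_bij' (fun p _ => p.2) (fun b _ => (a, b)) ?_ ?_ ?_ ?_
    · rintro ⟨x, y⟩ h
      simp [hT] at h ⊢
      obtain ⟨h, rfl⟩ := h
      exact h.2
    · intro b h
      simp [hT] at h ⊢
      exact ⟨ha, h⟩
    · rintro ⟨x, y⟩ h
      simp [hT] at h ⊢
      exact h.2.symm
    · simp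
  have hsum : T.card = D.card + I.card := by
    rw [← Finset.card_union_of_disjoint]
    · congr 1
      ext p
      simp only [hT, hD, hI, Finset.mem_union, Finset.mem_filter, Finset.mem_univ, true_and]
      tauto
    · rw [Finset.disjoint_left]
      intro p
      simp only [hD, hI, Finset.mem_filter, Finset.mem_univ, true_and]
      tauto
  have hne : D.card ≠ 1 := by
    intro h1
    obtain ⟨⟨a, b⟩, hab⟩ := Finset.card_eq_one.mp h1
    have key : ∀ x y, x ∈ S → y ∉ S → G.Adj x y → x = a ∧ y = b := by
      intro x y hx hy hxy
      have : (x, y) ∈ D := by simp [hD, hx, hy, hxy]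
      rw [hab] at this
      simpa using this
    have hmem : (a, b) ∈ D := by rw [hab]; simp
    simp only [hD, Finset.mem_filter, Finset.mem_univ, true_and] at hmem
    obtain ⟨haS, hbS, hadj⟩ := hmem
    refine hbridgeless s(a, b) hadj ?_
    rw [SimpleGraph.isBridge_iff]
    rintro ⟨w⟩
    have walk : ∀ x y, (G.deleteEdges {s(a, b)}).Walk x y → x ∈ S → y ∈ S := by
      intro x y w
      induction w with
      | nil => exact id
      | cons h _ ih =>
        intro hx
        apply ih
        by_contra hy
        rw [SimpleGraph.deleteEdges_adj] at h
        obtain ⟨rfl, rfl⟩ := key _ _ hx hy h.1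
        exact h.2 rfl
    exact hbS (walk _ _ w haS)
  obtain ⟨k, hk⟩ := hS
  obtain ⟨l, hl⟩ := hIeven
  omega

/-- Petersen's theorem: Every bridgeless cubic graph can be partitioned
into a perfect matching and a cycle cover: there is a perfect matching `M` such that
deleting its edges leaves a 2-regular spanning subgraph. -/
theorem stmt1 {V : Type} [Fintype V] (G : SimpleGraph V)
    (hcubic : ∀ v : V, (G.neighborSet v).ncard = 3)
    (hbridgeless : ∀ e ∈ G.edgeSet, ¬ G.IsBridge e) :
    ∃ M : G.Subgraph, M.IsPerfectMatching ∧
      ∀ v : V, ((G.deleteEdges M.edgeSet).neighborSet v).ncard = 2 := by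
  classical
  have hex : ∃ M : G.Subgraph, M.IsPerfectMatching := by
    rw [SimpleGraph.tutte]
    intro u hu
    unfold SimpleGraph.IsTutteViolator at hu
    set H := ((⊤ : G.Subgraph).deleteVerts u) with hH
    rw [Set.ncard_eq_toFinset_card', Set.ncard_eq_toFinset_card'] at hu
    set P := Finset.univ.filter (fun p : V × V => p.2 ∈ u ∧ G.Adj p.1 p.2) with hP
    have h1 : P.card ≤ 3 * u.toFinset.card := by
      refine Finset.card_le_mul_card_image_of_maps_to (f := Prod.snd) ?_ 3 ?_
      · intro p hp
        simp only [hP, Finset.mem_filter] at hp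
        simpa using hp.2.1
      · intro b hb
        rw [← hcubic b, Set.ncard_eq_toFinset_card']
        refine Finset.card_le_card_of_injOn Prod.fst ?_ ?_
        · rintro ⟨x, y⟩ h
          simp [hP] at h ⊢
          obtain ⟨h, rfl⟩ := h
          exact h.2.symm
        · rintro ⟨x, y⟩ h ⟨x', y'⟩ h' hxx
          simp at h h' hxx ⊢
          exact ⟨hxx, h.2.trans h'.2.symm⟩
    have h2 : H.coe.oddComponents.toFinset.card * 3 ≤ P.card * 1 := by
      refine Finset.card_mul_le_card_mul
        (fun (c : H.coe.ConnectedComponent) (p : V × V) => p.1 ∈ Subtype.val '' c.supp) ?_ ?_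
      · intro c hc
        have hodd : Odd (Subtype.val '' c.supp).toFinset.card := by
          rw [← Set.ncard_eq_toFinset_card', Set.ncard_image_of_injective _ Subtype.val_injective]
          simpa using hc
        refine (three_le_cut G hcubic hbridgeless _ hodd).trans (Finset.card_le_card ?_)
        rintro ⟨x, y⟩ h
        simp only [Finset.mem_filter, Finset.mem_univ, true_and, Set.mem_toFinset] at h
        obtain ⟨hx, hy, hxy⟩ := h
        simp only [Finset.bipartiteAbove, hP, Finset.mem_filter, Finset.mem_univ, true_and]
        refine ⟨⟨?_, hxy⟩, hx⟩
        by_contra hyu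
        obtain ⟨x', hx', rfl⟩ := hx
        apply hy
        have hyH : y ∈ H.verts := by simp [hH, hyu]
        refine ⟨⟨y, hyH⟩, ?_, rfl⟩
        have hxu : (x' : V) ∉ u := x'.2.2
        have hadj : H.coe.Adj x' ⟨y, hyH⟩ := by
          exact SimpleGraph.Subgraph.deleteVerts_adj.mpr ⟨trivial, hxu, trivial, hyu, hxy⟩
        rw [SimpleGraph.ConnectedComponent.mem_supp_iff] at hx' ⊢
        rw [← hx']
        exact SimpleGraph.ConnectedComponent.sound hadj.reachable.symm
      · intro p _
        rw [Finset.card_le_one]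
        intro c hc d hd
        simp only [Finset.bipartiteBelow, Finset.mem_filter] at hc hd
        obtain ⟨x, hx, hxp⟩ := hc.2
        obtain ⟨y, hy, hyp⟩ := hd.2
        obtain rfl : x = y := Subtype.ext (hxp.trans hyp.symm)
        rw [SimpleGraph.ConnectedComponent.mem_supp_iff] at hx hy
        exact hx.symm.trans hy
    have h3 : u.toFinset.card < H.coe.oddComponents.toFinset.card := by convert hu
    omega
  obtain ⟨M, hM⟩ := hex
  refine ⟨M, hM, fun v => ?_⟩
  obtain ⟨w, hw, huniq⟩ := hM.1 (hM.2 v)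
  have : (G.deleteEdges M.edgeSet).neighborSet v = G.neighborSet v \ {w} := by
    ext x
    simp only [SimpleGraph.mem_neighborSet, SimpleGraph.deleteEdges_adj, Set.mem_diff,
      Set.mem_singleton_iff, SimpleGraph.Subgraph.mem_edgeSet]
    refine and_congr_right fun _ => not_congr ⟨fun h => huniq _ h, ?_⟩
    rintro rfl
    exact hw
  rw [this, Set.ncard_diff_singleton_of_mem (by exact hw.adj_sub), hcubic]
end

section
/- Let G be a k-regular (k−1)-edge-connected multigraph with an even number of vertices, and let w be any real edge-weight vector. Then G has a perfect matching M with w(M) ≤ w(E)/k. -/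
open Classical in
/-- Degree of a vertex in a multigraph with edge-index type `ι` and endpoint map `ε`. -/
noncomputable def mgDegree {V ι : Type} [Fintype ι] (ε : ι → Sym2 V) (v : V) : ℕ :=
  (Finset.univ.filter fun i => v ∈ ε i).card

open Classical in
/-- The edges of the multigraph `ε` with exactly one endpoint in `S`. -/
noncomputable def mgCut {V ι : Type} [Fintype ι] (ε : ι → Sym2 V) (S : Finset V) :
    Finset ι :=
  Finset.univ.filter fun i => ∃ a ∈ S, ∃ b ∉ S, ε i = s(a, b)

/-- `M` is a perfect matching of the multigraph `ε`. -/
def mgIsPerfectMatching {V ι : Type} (ε : ι → Sym2 V) (M : Finset ι) : Prop :=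
  ∀ v : V, ∃! i, i ∈ M ∧ v ∈ ε i


namespace NP

open Finset Classical

/-- The edges with exactly one endpoint in `S` (endpoints given by `a`, `b`). -/
noncomputable def cut {V ι : Type} [Fintype ι] (a b : ι → V) (S : Finset V) : Finset ι :=
  univ.filter fun i => ¬ (a i ∈ S ↔ b i ∈ S)

/-- Edmonds' perfect matching polytope description. -/
structure InP {V ι : Type} [Fintype ι] (a b : ι → V) (x : ι → ℝ) : Prop where
  nonneg : ∀ i, 0 ≤ x i
  loop : ∀ i, a i = b i → x i = 0
  deg : ∀ v, ∑ i ∈ cut a b {v}, x i = 1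
  odd : ∀ S : Finset V, Odd S.card → 1 ≤ ∑ i ∈ cut a b S, x i

/-- The conclusion: a perfect matching in the support of `x` of weight at most `w · x`. -/
def Good {V ι : Type} [Fintype ι] (a b : ι → V) (x w : ι → ℝ) : Prop :=
  ∃ M : Finset ι, (∀ i ∈ M, 0 < x i) ∧ (∀ v, (M ∩ cut a b {v}).card = 1) ∧
    ∑ i ∈ M, w i ≤ ∑ i, w i * x i

/-- Matching of the side `S` of a tight cut. -/
def Half {V ι : Type} [Fintype ι] (a b : ι → V) (x : ι → ℝ) (S : Finset V) (M : Finset ι) : Prop :=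
  (∀ i ∈ M, 0 < x i ∧ (a i ∈ S ∨ b i ∈ S)) ∧ (∀ v ∈ S, (M ∩ cut a b {v}).card = 1) ∧
    (M ∩ cut a b S).card = 1

section
set_option linter.unusedSectionVars false
variable {V ι : Type} [Fintype V] [Fintype ι]

lemma mem_cut (a b : ι → V) (S : Finset V) (i : ι) :
    i ∈ cut a b S ↔ ¬ (a i ∈ S ↔ b i ∈ S) := by simp [cut]

lemma cut_compl (a b : ι → V) (S : Finset V) : cut a b Sᶜ = cut a b S := by
  ext i; simp only [mem_cut, mem_compl]; tauto

/-- contraction map -/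
noncomputable def proj (S : Finset V) (v : V) : Option S :=
  if h : v ∈ S then some ⟨v, h⟩ else none

lemma cut_proj (a b : ι → V) (S : Finset V) (T : Finset (Option S)) :
    cut (fun i => proj S (a i)) (fun i => proj S (b i)) T
      = cut a b (univ.filter fun v => proj S v ∈ T) := by
  ext i; simp [mem_cut]

lemma card_proj (S : Finset V) (T : Finset (Option S)) (hS : Odd (Sᶜ.card)) (hT : Odd T.card) :
    Odd (univ.filter fun v => proj S v ∈ T).card := by
  have h1 : (univ.filter fun v => proj S v ∈ T).card
      = ∑ t ∈ T, (univ.filter fun v => proj S v = t).card := by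
    rw [card_eq_sum_card_fiberwise (f := proj S) (t := T)]
    · refine sum_congr rfl fun t ht => ?_
      congr 1; ext v; simp; rintro rfl; exact ht
    · intro v hv; simpa using hv
  have h2 : ∀ t : Option S, Odd (univ.filter fun v => proj S v = t).card := by
    intro t
    cases t with
    | none =>
      convert hS using 2
      ext v; simp [proj]
    | some s =>
      have : (univ.filter fun v => proj S v = some s) = {s.1} := by
        ext v; simp [proj, Subtype.ext_iff]
        rintro rfl; exact s.2
      rw [this]; simp
  rw [h1, Finset.odd_sum_iff_odd_card_odd]
  convert hT using 2
  ext t; simp [h2]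

lemma half_exists (a b : ι → V) (x : ι → ℝ) (hx : InP a b x) (S : Finset V)
    (hS : Odd S.card) (hSc : Odd (Sᶜ.card)) (hSc1 : 1 < Sᶜ.card)
    (ht : ∑ i ∈ cut a b S, x i = 1)
    (IH : ∀ (V' : Type) [Fintype V'], Fintype.card V' < Fintype.card V →
      Even (Fintype.card V') → ∀ (a b : ι → V') (x : ι → ℝ), InP a b x → ∀ w, Good a b x w)
    (w : ι → ℝ) :
    ∃ M, Half a b x S M ∧
      ∑ i ∈ M, w i ≤ ∑ i ∈ univ.filter (fun i => a i ∈ S ∨ b i ∈ S), w i * x i := by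
  set x1 : ι → ℝ := fun i => if a i ∈ S ∨ b i ∈ S then x i else 0 with hx1
  have hcard : Fintype.card (Option S) < Fintype.card V := by
    rw [Fintype.card_option, Fintype.card_coe, ← card_add_card_compl S]; omega
  have heven : Even (Fintype.card (Option S)) := by
    rw [Fintype.card_option, Fintype.card_coe]; exact hS.add_one
  have hsum : ∀ T : Finset (Option S),
      ∑ i ∈ cut (fun i => proj S (a i)) (fun i => proj S (b i)) T, x1 i
        = ∑ i ∈ cut a b (univ.filter fun v => proj S v ∈ T), x i := by
    intro T
    rw [cut_proj]
    refine sum_congr rfl fun i hi => ?_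
    simp only [hx1]
    rw [if_pos]
    by_contra hcon
    push Not at hcon
    rw [mem_cut] at hi
    have e1 : proj S (a i) = none := dif_neg hcon.1
    have e2 : proj S (b i) = none := dif_neg hcon.2
    simp [e1, e2] at hi
  have hsome : ∀ s : S, (univ.filter fun v => proj S v ∈ ({some s} : Finset (Option S))) = {s.1} := by
    intro s
    ext v; simp [proj, Subtype.ext_iff]
    rintro rfl; exact s.2
  have hnone : (univ.filter fun v => proj S v ∈ ({none} : Finset (Option S))) = Sᶜ := by
    ext v; simp [proj]
  have hP : InP (fun i => proj S (a i)) (fun i => proj S (b i)) x1 := by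
    refine ⟨?_, ?_, ?_, ?_⟩
    · intro i; simp only [hx1]; split_ifs
      · exact hx.nonneg i
      · exact le_rfl
    · intro i hi
      simp only [hx1]
      split_ifs with h
      · apply hx.loop
        simp only [proj] at hi
        split_ifs at hi with h1 h2 h2
        · simpa using hi
        · tauto
      · rfl
    · intro v
      rw [hsum]
      cases v with
      | none => rw [hnone, cut_compl, ht]
      | some s => rw [hsome, hx.deg]
    · intro T hT
      rw [hsum]
      exact hx.odd _ (card_proj S T hSc hT)
  obtain ⟨M, hM1, hM2, hM3⟩ := IH (Option S) hcard heven _ _ x1 hP w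
  refine ⟨M, ⟨?_, ?_, ?_⟩, ?_⟩
  · intro i hi
    have := hM1 i hi
    simp only [hx1] at this
    split_ifs at this with h
    · exact ⟨this, h⟩
    · exact absurd this (lt_irrefl _)
  · intro v hv
    have := hM2 (some ⟨v, hv⟩)
    rwa [cut_proj, hsome] at this
  · have := hM2 none
    rwa [cut_proj, hnone, cut_compl] at this
  · refine hM3.trans (le_of_eq ?_)
    rw [sum_filter]
    refine sum_congr rfl fun i _ => ?_
    simp only [hx1]; split_ifs <;> simp

lemma tight_case (a b : ι → V) (x : ι → ℝ) (hx : InP a b x) (S : Finset V)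
    (hS : Odd S.card) (hSc : Odd (Sᶜ.card)) (hS1 : 1 < S.card) (hSc1 : 1 < Sᶜ.card)
    (ht : ∑ i ∈ cut a b S, x i = 1)
    (IH : ∀ (V' : Type) [Fintype V'], Fintype.card V' < Fintype.card V →
      Even (Fintype.card V') → ∀ (a b : ι → V') (x : ι → ℝ), InP a b x → ∀ w, Good a b x w)
    (w : ι → ℝ) : Good a b x w := by
  have H1 := half_exists a b x hx S hS hSc hSc1 ht IH
  have H2 := half_exists a b x hx Sᶜ hSc (by simpa using hS) (by simpa using hS1)
    (by rw [cut_compl]; exact ht) IH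
  -- minimal matchings on the side `Sᶜ` through each cut edge
  have hN : ∀ e, ∃ N, e ∈ cut a b S → 0 < x e → Half a b x Sᶜ N ∧ e ∈ N ∧
      ∀ N', Half a b x Sᶜ N' → e ∈ N' → ∑ i ∈ N, w i ≤ ∑ i ∈ N', w i := by
    intro e
    by_cases he : e ∈ cut a b S ∧ 0 < x e
    · obtain ⟨he, hpos⟩ := he
      obtain ⟨N0, hN0, hw0⟩ := H2 (fun i => if i = e then -1 else 0)
      have heN : e ∈ N0 := by
        by_contra hne
        rw [sum_eq_zero (fun i hi => if_neg (by rintro rfl; exact hne hi))] at hw0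
        simp only [ite_mul, zero_mul, sum_ite_eq', mem_filter, mem_univ, true_and] at hw0
        rw [if_pos] at hw0
        · linarith
        · rw [mem_cut] at he; simp only [mem_compl]; tauto
      obtain ⟨N, hNm, hmin⟩ := exists_min_image
        (univ.filter fun N => Half a b x Sᶜ N ∧ e ∈ N) (fun N => ∑ i ∈ N, w i)
        ⟨N0, by simp [hN0, heN]⟩
      simp only [mem_filter, mem_univ, true_and] at hNm hmin
      exact ⟨N, fun _ _ => ⟨hNm.1, hNm.2, fun N' h1 h2 => hmin N' ⟨h1, h2⟩⟩⟩
    · exact ⟨∅, fun h1 h2 => absurd ⟨h1, h2⟩ he⟩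
  choose N hN using hN
  set m : ι → ℝ := fun e => ∑ i ∈ N e, w i with hm
  obtain ⟨M, hM, hwM⟩ := H1 (fun i => if i ∈ cut a b S then m i else w i)
  obtain ⟨N', hN', hwN'⟩ := H2 (fun i => if i ∈ cut a b S then w i - m i else w i)
  -- the weight of `N'` is nonnegative
  have key : ∀ (A : Finset ι) (e : ι) (f g : ι → ℝ), A ∩ cut a b S = {e} →
      ∑ i ∈ A, (if i ∈ cut a b S then f i else g i) = f e + ∑ i ∈ A.erase e, g i := by
    intro A e f g hA
    have heA : e ∈ A ∩ cut a b S := by rw [hA]; simp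
    rw [mem_inter] at heA
    rw [← add_sum_erase A _ heA.1, if_pos heA.2]
    congr 1
    refine sum_congr rfl fun i hi => if_neg fun hc => ?_
    have : i ∈ A ∩ cut a b S := mem_inter.2 ⟨mem_of_mem_erase hi, hc⟩
    rw [hA, mem_singleton] at this
    exact ne_of_mem_erase hi this
  obtain ⟨e', he'⟩ := card_eq_one.1 hN'.2.2
  rw [cut_compl] at he'
  have he'm : e' ∈ N' ∩ cut a b S := by rw [he']; simp
  rw [mem_inter] at he'm
  have hnn : 0 ≤ ∑ i ∈ N', (if i ∈ cut a b S then w i - m i else w i) := by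
    rw [key N' e' _ _ he']
    have h1 := (hN e' he'm.2 (hN'.1 e' he'm.1).1).2.2 N' hN' he'm.1
    have h2 := add_sum_erase N' w he'm.1
    simp only [hm]
    linarith
  obtain ⟨e, he⟩ := card_eq_one.1 hM.2.2
  have hem : e ∈ M ∩ cut a b S := by rw [he]; simp
  rw [mem_inter] at hem
  obtain ⟨hNe, heN, -⟩ := hN e hem.2 (hM.1 e hem.1).1
  have hNcut : N e ∩ cut a b S = {e} := by
    obtain ⟨f, hf⟩ := card_eq_one.1 hNe.2.2
    rw [cut_compl] at hf
    have : e ∈ N e ∩ cut a b S := mem_inter.2 ⟨heN, hem.2⟩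
    rw [hf, mem_singleton] at this
    rw [hf, this]
  have hMc : ∀ i ∈ M, i ∈ cut a b S → i = e := fun i h1 h2 => by
    have : i ∈ M ∩ cut a b S := mem_inter.2 ⟨h1, h2⟩
    rwa [he, mem_singleton] at this
  have hNc : ∀ i ∈ N e, i ∈ cut a b S → i = e := fun i h1 h2 => by
    have : i ∈ N e ∩ cut a b S := mem_inter.2 ⟨h1, h2⟩
    rwa [hNcut, mem_singleton] at this
  have hdisj : Disjoint (M.erase e) (N e) := by
    rw [Finset.disjoint_left]
    intro i hi hi2
    have h1 := (hM.1 i (mem_of_mem_erase hi)).2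
    have h2 := (hNe.1 i hi2).2
    simp only [mem_compl] at h2
    have : i ∈ cut a b S := by rw [mem_cut]; tauto
    exact ne_of_mem_erase hi (hNc i hi2 this)
  refine ⟨M.erase e ∪ N e, ?_, ?_, ?_⟩
  · intro i hi
    rcases mem_union.1 hi with h | h
    · exact (hM.1 i (mem_of_mem_erase h)).1
    · exact (hNe.1 i h).1
  · intro v
    by_cases hv : v ∈ S
    · rw [← hM.2.1 v hv]
      congr 1
      ext i
      simp only [mem_inter, mem_union, mem_erase]
      constructor
      · rintro ⟨h | h, hc⟩
        · exact ⟨h.2, hc⟩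
        · refine ⟨?_, hc⟩
          have h2 := (hNe.1 i h).2
          simp only [mem_compl] at h2
          have hc' := hc
          rw [mem_cut] at hc'
          simp only [mem_singleton] at hc'
          have : i ∈ cut a b S := by
            rw [mem_cut]
            by_cases h3 : a i = v
            · rw [h3] at h2 ⊢; tauto
            · have h4 : b i = v := by tauto
              rw [h4] at h2 ⊢; tauto
          rw [hNc i h this]; exact hem.1
      · rintro ⟨h, hc⟩
        refine ⟨?_, hc⟩
        by_cases hie : i = e
        · right; rw [hie]; exact heN
        · left; exact ⟨hie, h⟩
    · rw [← hNe.2.1 v (by simpa using hv)]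
      congr 1
      ext i
      simp only [mem_inter, mem_union, mem_erase]
      constructor
      · rintro ⟨h | h, hc⟩
        · exfalso
          have h2 := (hM.1 i h.2).2
          have hc' := hc
          rw [mem_cut] at hc'
          simp only [mem_singleton] at hc'
          have : i ∈ cut a b S := by
            rw [mem_cut]
            by_cases h3 : a i = v
            · rw [h3] at h2 ⊢; tauto
            · have h4 : b i = v := by tauto
              rw [h4] at h2 ⊢; tauto
          exact h.1 (hMc i h.2 this)
        · exact ⟨h, hc⟩
      · rintro ⟨h, hc⟩
        exact ⟨Or.inr h, hc⟩
  · rw [sum_union hdisj]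
    have h1 := key M e m w he
    have h2 : ∑ i ∈ univ.filter (fun i => a i ∈ S ∨ b i ∈ S),
          (if i ∈ cut a b S then m i else w i) * x i
        + ∑ i ∈ univ.filter (fun i => a i ∈ Sᶜ ∨ b i ∈ Sᶜ),
          (if i ∈ cut a b S then w i - m i else w i) * x i = ∑ i, w i * x i := by
      rw [sum_filter, sum_filter, ← sum_add_distrib]
      refine sum_congr rfl fun i _ => ?_
      simp only [mem_cut, mem_compl]
      by_cases h3 : a i ∈ S <;> by_cases h4 : b i ∈ S <;> simp [h3, h4]
      all_goals ring
    have h3 : m e = ∑ i ∈ N e, w i := rfl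
    linarith

/-- The simple graph of the support of `x`. -/
def supp (a b : ι → V) (x : ι → ℝ) : SimpleGraph V where
  Adj u v := u ≠ v ∧ ∃ i, 0 < x i ∧ ((a i = u ∧ b i = v) ∨ (a i = v ∧ b i = u))
  symm := ⟨by
    rintro u v ⟨h, i, hi, h'⟩
    exact ⟨h.symm, i, hi, h'.symm⟩⟩
  loopless := ⟨fun u h => h.1 rfl⟩

lemma not_violator (a b : ι → V) (x : ι → ℝ) (hx : InP a b x) (u : Set V) :
    ¬ (supp a b x).IsTutteViolator u := by
  intro hu
  unfold SimpleGraph.IsTutteViolator at hu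
  set H := ((⊤ : (supp a b x).Subgraph).deleteVerts u).coe with hH
  have hmem : ∀ v, v ∉ u → v ∈ ((⊤ : (supp a b x).Subgraph).deleteVerts u).verts := by
    intro v hv; simp [hv]
  have hmem' : ∀ v, v ∈ ((⊤ : (supp a b x).Subgraph).deleteVerts u).verts → v ∉ u := by
    intro v hv; simpa using hv
  set K : H.ConnectedComponent → Finset V := fun c =>
    univ.filter fun v => ∃ h : v ∈ ((⊤ : (supp a b x).Subgraph).deleteVerts u).verts,
      H.connectedComponentMk ⟨v, h⟩ = c with hK
  have hKu : ∀ c v, v ∈ K c → v ∉ u := by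
    intro c v hv
    simp only [hK, mem_filter] at hv
    exact hmem' v hv.2.1
  have hKinj : ∀ c c' v, v ∈ K c → v ∈ K c' → c = c' := by
    intro c c' v hv hv'
    simp only [hK, mem_filter, mem_univ, true_and] at hv hv'
    obtain ⟨h, rfl⟩ := hv
    obtain ⟨h', rfl⟩ := hv'
    rfl
  have hKcard : ∀ c, (K c).card = c.supp.ncard := by
    intro c
    rw [← Set.ncard_image_of_injective c.supp Subtype.val_injective, ← Set.ncard_coe_finset]
    congr 1
    ext v
    simp [hK]
  have hKadj : ∀ i, 0 < x i → a i ∉ u → b i ∉ u → ∀ c, a i ∈ K c ↔ b i ∈ K c := by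
    intro i hi ha hb c
    have hadj : H.Adj ⟨a i, hmem _ ha⟩ ⟨b i, hmem _ hb⟩ := by
      have : (supp a b x).Adj (a i) (b i) :=
        ⟨fun h => by rw [hx.loop i h] at hi; exact lt_irrefl _ hi, i, hi, Or.inl ⟨rfl, rfl⟩⟩
      simp [hH, ha, hb, this]
    have h2 : H.connectedComponentMk ⟨a i, hmem _ ha⟩ = H.connectedComponentMk ⟨b i, hmem _ hb⟩ :=
      SimpleGraph.ConnectedComponent.eq.2 hadj.reachable
    simp only [hK, mem_filter, mem_univ, true_and]
    constructor
    · rintro ⟨h, rfl⟩; exact ⟨hmem _ hb, h2.symm⟩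
    · rintro ⟨h, rfl⟩; exact ⟨hmem _ ha, h2⟩
  set C : Finset H.ConnectedComponent := H.oddComponents.toFinset with hC
  set U : Finset V := u.toFinset with hU
  have hlt : U.card < C.card := by
    rw [Set.ncard_eq_toFinset_card', Set.ncard_eq_toFinset_card'] at hu
    convert hu using 2
  have hcount : ∀ i, 0 < x i → (C.filter fun c => i ∈ cut a b (K c)).card
      ≤ (U.filter fun v => i ∈ cut a b {v}).card := by
    intro i hi
    have hab : a i ≠ b i := fun h => by rw [hx.loop i h] at hi; exact lt_irrefl _ hi
    by_cases ha : a i ∈ u <;> by_cases hb : b i ∈ u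
    · rw [filter_false_of_mem]
      · simp
      · intro c _ hc
        rw [mem_cut] at hc
        exact hc (iff_of_false (fun h => hKu c _ h ha) (fun h => hKu c _ h hb))
    · refine le_trans (b := 1) (card_le_one.2 ?_) (card_pos.2 ⟨a i, ?_⟩)
      · intro c hc c' hc'
        simp only [mem_filter, mem_cut] at hc hc'
        have h1 : a i ∉ K c := fun h => hKu c _ h ha
        have h2 : a i ∉ K c' := fun h => hKu c' _ h ha
        refine hKinj c c' (b i) ?_ ?_
        · by_contra h
          exact hc.2 (iff_of_false h1 h)
        · by_contra h
          exact hc'.2 (iff_of_false h2 h)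
      · simp only [mem_filter, mem_cut, mem_singleton, hU, Set.mem_toFinset]
        exact ⟨ha, by simp [hab.symm]⟩
    · refine le_trans (b := 1) (card_le_one.2 ?_) (card_pos.2 ⟨b i, ?_⟩)
      · intro c hc c' hc'
        simp only [mem_filter, mem_cut] at hc hc'
        have h1 : b i ∉ K c := fun h => hKu c _ h hb
        have h2 : b i ∉ K c' := fun h => hKu c' _ h hb
        refine hKinj c c' (a i) ?_ ?_
        · by_contra h
          exact hc.2 (iff_of_false h h1)
        · by_contra h
          exact hc'.2 (iff_of_false h h2)
      · simp only [mem_filter, mem_cut, mem_singleton, hU, Set.mem_toFinset]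
        exact ⟨hb, by simp [hab]⟩
    · rw [filter_false_of_mem]
      · simp
      · intro c _ hc
        rw [mem_cut] at hc
        exact hc (hKadj i hi ha hb c)
  have swap : ∀ {α : Type} (A : Finset α) (T : α → Finset V),
      ∑ c ∈ A, ∑ i ∈ cut a b (T c), x i
        = ∑ i, ((A.filter fun c => i ∈ cut a b (T c)).card : ℝ) * x i := by
    intro α A T
    have : ∀ c, ∑ i ∈ cut a b (T c), x i = ∑ i, if i ∈ cut a b (T c) then x i else 0 := by
      intro c; rw [← sum_filter]; simp
    simp_rw [this]
    rw [sum_comm]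
    refine sum_congr rfl fun i _ => ?_
    rw [← sum_filter, sum_const, nsmul_eq_mul]
  have h1 : (C.card : ℝ) ≤ ∑ c ∈ C, ∑ i ∈ cut a b (K c), x i := by
    rw [card_eq_sum_ones, Nat.cast_sum]
    refine sum_le_sum fun c hc => ?_
    have : Odd (K c).card := by
      rw [hKcard]; simpa [hC] using hc
    simpa using hx.odd _ this
  have h2 : ∑ v ∈ U, ∑ i ∈ cut a b {v}, x i = (U.card : ℝ) := by
    simp [hx.deg]
  have h3 : ∑ c ∈ C, ∑ i ∈ cut a b (K c), x i ≤ ∑ v ∈ U, ∑ i ∈ cut a b {v}, x i := by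
    rw [swap C K, swap U (fun v => {v})]
    refine sum_le_sum fun i _ => ?_
    rcases (hx.nonneg i).lt_or_eq with h | h
    · exact mul_le_mul_of_nonneg_right (by exact_mod_cast hcount i h) h.le
    · simp [← h]
  have : (C.card : ℝ) ≤ U.card := by linarith
  have : C.card ≤ U.card := by exact_mod_cast this
  omega

lemma exists_matching (a b : ι → V) (x : ι → ℝ) (hx : InP a b x) :
    ∃ M : Finset ι, (∀ i ∈ M, 0 < x i) ∧ (∀ v, (M ∩ cut a b {v}).card = 1) := by
  obtain ⟨P, hP⟩ := SimpleGraph.tutte.2 (not_violator a b x hx)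
  rw [SimpleGraph.Subgraph.isPerfectMatching_iff] at hP
  have hg : ∀ e : Sym2 V, ∃ i : Option ι, e ∈ P.edgeSet →
      ∃ j, i = some j ∧ 0 < x j ∧ s(a j, b j) = e := by
    intro e
    by_cases he : e ∈ P.edgeSet
    · induction e with
      | h p q =>
        obtain ⟨-, i, hi, h⟩ := P.adj_sub he
        refine ⟨some i, fun _ => ⟨i, rfl, hi, ?_⟩⟩
        rw [Sym2.eq_iff]; tauto
    · exact ⟨none, fun h => absurd h he⟩
  choose g hg using hg
  refine ⟨univ.filter fun i => s(a i, b i) ∈ P.edgeSet ∧ g s(a i, b i) = some i, ?_, ?_⟩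
  · intro i hi
    simp only [mem_filter, mem_univ, true_and] at hi
    obtain ⟨j, hj, hj2, -⟩ := hg _ hi.1
    rw [hi.2] at hj
    obtain rfl := Option.some_injective _ hj
    exact hj2
  · intro v
    obtain ⟨q, hq, hq'⟩ := hP v
    obtain ⟨j, hj, hjx, hje⟩ := hg s(v, q) hq
    have hvq : v ≠ q := (P.adj_sub hq).ne
    rw [card_eq_one]
    refine ⟨j, ?_⟩
    ext i
    simp only [mem_inter, mem_filter, mem_univ, true_and, mem_singleton, mem_cut]
    constructor
    · rintro ⟨⟨h1, h2⟩, h3⟩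
      have h4 : s(a i, b i) = s(v, q) := by
        by_cases hav : a i = v
        · rw [hav] at h1 ⊢
          exact congrArg (fun z => s(v, z)) (hq' _ h1)
        · have hbv : b i = v := by tauto
          rw [hbv, Sym2.eq_swap] at h1 ⊢
          exact congrArg (fun z => s(v, z)) (hq' _ h1)
      rw [h4, hj] at h2
      exact (Option.some_injective _ h2).symm
    · rintro rfl
      rw [hje]
      refine ⟨⟨hq, hj⟩, ?_⟩
      rcases Sym2.eq_iff.1 hje with ⟨h1, h2⟩ | ⟨h1, h2⟩
      · rw [h1, h2]; simp [hvq.symm]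
      · rw [h1, h2]; simp [hvq.symm]

lemma max_step {J : Type} (A : Finset J) (c d : J → ℝ) (hc : ∀ j ∈ A, 0 ≤ c j)
    (hd : ∃ j ∈ A, 0 < d j) :
    ∃ t, 0 ≤ t ∧ (∀ j ∈ A, t * d j ≤ c j) ∧ ∃ j ∈ A, 0 < d j ∧ t * d j = c j := by
  obtain ⟨j0, hj0, hd0⟩ := hd
  obtain ⟨j, hj, hmin⟩ := exists_min_image (A.filter fun j => 0 < d j) (fun j => c j / d j)
    ⟨j0, by simp [hj0, hd0]⟩
  simp only [mem_filter] at hj hmin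
  have h0 : 0 ≤ c j / d j := div_nonneg (hc j hj.1) hj.2.le
  refine ⟨c j / d j, h0, ?_, j, hj.1, hj.2, div_mul_cancel₀ _ hj.2.ne'⟩
  intro i hi
  by_cases hdi : 0 < d i
  · exact (le_div_iff₀ hdi).1 (hmin i ⟨hi, hdi⟩)
  · exact (mul_nonpos_of_nonneg_of_nonpos h0 (not_lt.1 hdi)).trans (hc i hi)

lemma single_of_card (a b : ι → V) (M : Finset ι) (hM : ∀ v, (M ∩ cut a b {v}).card = 1)
    (S : Finset V) (hS : S.card = 1) : (M ∩ cut a b S).card = 1 := by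
  obtain ⟨v, rfl⟩ := card_eq_one.1 hS
  exact hM v

lemma step (hV : Even (Fintype.card V)) (a b : ι → V)
    (IH : ∀ (V' : Type) [Fintype V'], Fintype.card V' < Fintype.card V →
      Even (Fintype.card V') → ∀ (a b : ι → V') (x : ι → ℝ), InP a b x → ∀ w, Good a b x w)
    (w : ι → ℝ) :
    ∀ (n : ℕ) (x : ι → ℝ), (univ.filter fun i => 0 < x i).card = n → InP a b x →
      Good a b x w := by
  intro n
  induction n using Nat.strong_induction_on with
  | _ n ih =>
  intro x hn hx
  obtain ⟨M, hMx, hM⟩ := exists_matching a b x hx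
  by_cases hle : ∑ i ∈ M, w i ≤ ∑ i, w i * x i
  · exact ⟨M, hMx, hM, hle⟩
  push Not at hle
  rcases isEmpty_or_nonempty V with hVe | ⟨⟨v0⟩⟩
  · have : IsEmpty ι := ⟨fun i => hVe.elim (a i)⟩
    exact ⟨∅, by simp, fun v => hVe.elim v, by simp⟩
  obtain ⟨e0, he0⟩ := card_eq_one.1 (hM v0)
  have he0' : e0 ∈ M ∩ cut a b {v0} := by rw [he0]; simp
  rw [mem_inter] at he0'
  have hx1 : x e0 ≤ 1 := by
    rw [← hx.deg v0]
    exact single_le_sum (f := x) (fun i _ => hx.nonneg i) he0'.2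
  set ch : ι → ℝ := fun i => if i ∈ M then 1 else 0 with hch
  have hchcut : ∀ S, ∑ i ∈ cut a b S, ch i = ((M ∩ cut a b S).card : ℝ) := by
    intro S
    simp only [hch]
    rw [sum_ite_mem, sum_const, nsmul_eq_mul, mul_one, inter_comm]
  set A : Finset (ι ⊕ Finset V) := (univ.filter fun j =>
    match j with
    | Sum.inl i => i ∈ M
    | Sum.inr S => Odd S.card) with hA
  obtain ⟨t, ht0, htle, j, hjA, hdj, htj⟩ := max_step A
    (fun j => match j with
      | Sum.inl i => x i
      | Sum.inr S => ∑ i ∈ cut a b S, x i - 1)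
    (fun j => match j with
      | Sum.inl i => 1
      | Sum.inr S => ((M ∩ cut a b S).card : ℝ) - 1)
    (by
      rintro (i | S) hj
      · exact hx.nonneg i
      · simp only [hA, mem_filter, mem_univ, true_and] at hj
        have := hx.odd S hj
        simp only; linarith)
    ⟨Sum.inl e0, by simp [hA, he0'.1], by simp⟩
  have hti : ∀ i ∈ M, t ≤ x i := by
    intro i hi
    simpa using htle (Sum.inl i) (by simp [hA, hi])
  have htS : ∀ S : Finset V, Odd S.card →
      t * (((M ∩ cut a b S).card : ℝ) - 1) ≤ ∑ i ∈ cut a b S, x i - 1 := by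
    intro S hS
    simpa using htle (Sum.inr S) (by simp [hA, hS])
  have ht1 : t ≤ 1 := (hti e0 he0'.1).trans hx1
  have hnn : ∀ i, 0 ≤ x i - t * ch i := by
    intro i
    simp only [hch]
    split_ifs with h
    · have := hti i h; linarith
    · simpa using hx.nonneg i
  have hdegy : ∀ v, ∑ i ∈ cut a b {v}, (x i - t * ch i) = 1 - t := by
    intro v
    rw [sum_sub_distrib, ← mul_sum, hchcut, hM, hx.deg]; simp
  have hwM : ∑ i, w i * ch i = ∑ i ∈ M, w i := by
    simp [hch]
  rcases ht1.lt_or_eq with hlt | heq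
  swap
  · exfalso
    have hxe : ∀ i, x i = ch i := by
      intro i
      by_cases hl : a i = b i
      · have h0 := hx.loop i hl
        simp only [hch]
        rw [if_neg, h0]
        intro hi
        have := hMx i hi
        linarith
      · have h1 := hdegy (a i)
        rw [heq, sub_self, sum_eq_zero_iff_of_nonneg] at h1
        · have := h1 i (by rw [mem_cut]; simp [Ne.symm hl])
          linarith
        · intro i _; have := hnn i; rwa [heq] at this
    rw [← hwM] at hle
    simp [hxe] at hle
  -- the new point
  have hpos : 0 < 1 - t := by linarith
  set y : ι → ℝ := fun i => (x i - t * ch i) / (1 - t) with hy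
  have hycut : ∀ S, ∑ i ∈ cut a b S, y i
      = (∑ i ∈ cut a b S, x i - t * ((M ∩ cut a b S).card : ℝ)) / (1 - t) := by
    intro S
    simp only [hy]
    rw [← sum_div, sum_sub_distrib, ← mul_sum, hchcut]
  have hyP : InP a b y := by
    refine ⟨fun i => div_nonneg (hnn i) hpos.le, ?_, ?_, ?_⟩
    · intro i hi
      have h0 := hx.loop i hi
      simp only [hy, hch]
      rw [if_neg, h0]
      · simp
      · intro hi
        have := hMx i hi
        linarith
    · intro v
      rw [hycut, hM, hx.deg]
      simp [hpos.ne']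
    · intro S hS
      rw [hycut, le_div_iff₀ hpos]
      have := htS S hS
      linarith
  have hyx : ∀ i, 0 < y i → 0 < x i := by
    intro i hi
    by_contra hcon
    have h0 : x i = 0 := le_antisymm (not_lt.1 hcon) (hx.nonneg i)
    have : i ∉ M := fun h => hcon (hMx i h)
    simp [hy, hch, h0, this] at hi
  have hwy : ∑ i, w i * y i ≤ ∑ i, w i * x i := by
    have h1 : ∑ i, w i * y i = (∑ i, w i * x i - t * ∑ i ∈ M, w i) / (1 - t) := by
      rw [← hwM, mul_sum, ← sum_sub_distrib, sum_div]
      refine sum_congr rfl fun i _ => ?_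
      simp only [hy]; ring
    rw [h1, div_le_iff₀ hpos]
    nlinarith
  have hgood : Good a b y w → Good a b x w := by
    rintro ⟨M', h1, h2, h3⟩
    exact ⟨M', fun i hi => hyx i (h1 i hi), h2, h3.trans hwy⟩
  apply hgood
  rcases j with i | S
  · simp only [hA, mem_filter, mem_univ, true_and] at hjA
    simp only [mul_one] at htj
    refine ih _ ?_ y rfl hyP
    rw [← hn]
    apply card_lt_card
    rw [ssubset_iff_of_subset]
    · refine ⟨i, by simp [hMx i hjA], ?_⟩
      simp [hy, hch, hjA, htj]
    · intro i hi
      simp only [mem_filter, mem_univ, true_and] at hi ⊢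
      exact hyx i hi
  · simp only [hA, mem_filter, mem_univ, true_and] at hjA
    simp only at htj hdj
    have hScO : Odd (Sᶜ.card) := by
      have h1 := card_add_card_compl S
      rw [← h1, Nat.even_add'] at hV
      exact hV.1 hjA
    have hne : (M ∩ cut a b S).card ≠ 1 := by
      intro h; rw [h] at hdj; simp at hdj
    have hS1 : 1 < S.card := by
      have := hjA.pos
      have : S.card ≠ 1 := fun h => hne (single_of_card a b M hM S h)
      omega
    have hSc1 : 1 < Sᶜ.card := by
      have := hScO.pos
      have : Sᶜ.card ≠ 1 := fun h => hne (by
        rw [← cut_compl]; exact single_of_card a b M hM _ h)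
      omega
    refine tight_case a b y hyP S hjA hScO hS1 hSc1 ?_ IH w
    rw [hycut, div_eq_one_iff_eq hpos.ne']
    linarith

end

theorem edmonds {ι : Type} [Fintype ι] : ∀ (n : ℕ) (V : Type) [Fintype V], Fintype.card V = n →
    Even (Fintype.card V) → ∀ (a b : ι → V) (x : ι → ℝ), InP a b x → ∀ w, Good a b x w := by
  intro n
  induction n using Nat.strong_induction_on with
  | _ n ih =>
  intro V _ hn hV a b x hx w
  refine step hV a b ?_ w _ x rfl hx
  intro V' _ hlt he
  exact ih _ (hn ▸ hlt) V' rfl he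

end NP

/-- Naddef–Pulleyblank: A `k`-regular `(k-1)`-edge-connected multigraph
with an even number of vertices has, for any real edge weights `w`, a perfect matching
`M` with `w(M) ≤ w(E)/k`. -/
theorem stmt12 {V ι : Type} [Fintype V] [Fintype ι]
    (k : ℕ) (hk : 0 < k)
    (ε : ι → Sym2 V) (hloopless : ∀ i, ¬ (ε i).IsDiag)
    (hreg : ∀ v : V, mgDegree ε v = k)
    (hconn : ∀ S : Finset V, S.Nonempty → S ≠ Finset.univ → k - 1 ≤ (mgCut ε S).card)
    (heven : Even (Fintype.card V)) (w : ι → ℝ) :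
    ∃ M : Finset ι, mgIsPerfectMatching ε M ∧ ∑ i ∈ M, w i ≤ (∑ i, w i) / k := by
  classical
  have hab : ∀ i, ∃ p : V × V, ε i = s(p.1, p.2) := by
    intro i
    induction h : ε i with
    | h p q => exact ⟨(p, q), rfl⟩
  choose p hp using hab
  set a : ι → V := fun i => (p i).1 with ha
  set b : ι → V := fun i => (p i).2 with hb
  have hε : ∀ i, ε i = s(a i, b i) := hp
  have hne : ∀ i, a i ≠ b i := by
    intro i h
    apply hloopless i
    rw [hε, Sym2.mk_isDiag_iff]; exact h
  have hcut : ∀ S, mgCut ε S = NP.cut a b S := by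
    intro S
    ext i
    simp only [mgCut, NP.mem_cut, Finset.mem_filter, Finset.mem_univ, true_and, hε]
    constructor
    · rintro ⟨u, hu, v, hv, h⟩
      rcases Sym2.eq_iff.1 h with ⟨h1, h2⟩ | ⟨h1, h2⟩ <;> rw [h1, h2] <;> tauto
    · intro h
      by_cases h1 : a i ∈ S
      · exact ⟨a i, h1, b i, by tauto, rfl⟩
      · exact ⟨b i, by tauto, a i, h1, Sym2.eq_swap⟩
  have hinc : ∀ v i, i ∈ NP.cut a b {v} ↔ v ∈ ε i := by
    intro v i
    rw [NP.mem_cut, hε, Sym2.mem_iff, Finset.mem_singleton, Finset.mem_singleton]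
    have := hne i
    constructor
    · intro h
      by_cases h1 : a i = v
      · exact Or.inl h1.symm
      · right; symm; tauto
    · rintro (rfl | rfl)
      · simp [this.symm]
      · simp [this]
  have hdeg : ∀ v, (NP.cut a b {v}).card = k := by
    intro v
    rw [← hreg v, mgDegree]
    congr 1
    ext i
    simp [hinc]
  have hpar : ∀ S : Finset V, ∃ m, k * S.card = (NP.cut a b S).card + 2 * m := by
    intro S
    refine ⟨(Finset.univ.filter fun i => a i ∈ S ∧ b i ∈ S).card, ?_⟩
    have h1 : k * S.card = ∑ v ∈ S, ∑ i, if i ∈ NP.cut a b {v} then 1 else 0 := by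
      simp [hdeg, mul_comm]
    rw [h1, Finset.sum_comm, NP.cut, Finset.card_filter, Finset.card_filter, Finset.mul_sum,
      ← Finset.sum_add_distrib]
    refine Finset.sum_congr rfl fun i _ => ?_
    have h2 : ∀ v, (if i ∈ NP.cut a b {v} then 1 else 0)
        = (if a i = v then 1 else 0) + (if b i = v then 1 else 0) := by
      intro v
      have := hne i
      simp only [NP.mem_cut, Finset.mem_singleton]
      by_cases h1 : a i = v <;> by_cases h2 : b i = v <;> simp [h1, h2]
      exact this (h1.trans h2.symm)
    simp only [h2, Finset.sum_add_distrib, Finset.sum_ite_eq]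
    by_cases h3 : a i ∈ S <;> by_cases h4 : b i ∈ S <;> simp [h3, h4]
  have hk' : (0 : ℝ) < k := by exact_mod_cast hk
  have hP : NP.InP a b (fun _ => (1 : ℝ) / k) := by
    refine ⟨fun i => by positivity, fun i h => absurd h (hne i), ?_, ?_⟩
    · intro v
      rw [Finset.sum_const, hdeg, nsmul_eq_mul]
      field_simp
    · intro S hS
      have h1 := hconn S (Finset.card_pos.1 hS.pos) (by
        rintro rfl
        rw [Finset.card_univ] at hS
        exact (Nat.not_odd_iff_even.2 heven) hS)
      rw [hcut] at h1
      obtain ⟨m, hm⟩ := hpar S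
      have h2 : k ≤ (NP.cut a b S).card := by
        obtain ⟨r, hr⟩ := hS
        rw [hr] at hm
        have h3 : k * (2 * r + 1) = 2 * (k * r) + k := by ring
        omega
      rw [Finset.sum_const, nsmul_eq_mul, mul_one_div, le_div_iff₀ hk', one_mul]
      exact_mod_cast h2
  obtain ⟨M, -, hM, hw⟩ := NP.edmonds _ V rfl heven a b _ hP w
  refine ⟨M, ?_, ?_⟩
  · intro v
    obtain ⟨e, he⟩ := Finset.card_eq_one.1 (hM v)
    have h : ∀ i, (i ∈ M ∧ v ∈ ε i) ↔ i = e := by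
      intro i
      rw [← hinc, ← Finset.mem_singleton, ← he, Finset.mem_inter]
      
    exact ⟨e, (h e).2 rfl, fun i hi => (h i).1 hi⟩
  · refine hw.trans (le_of_eq ?_)
    rw [← Finset.sum_mul]; ring
end

section
/- Let G be a bridgeless cubic multigraph on n vertices. Then G has a cycle cover (a spanning set of vertex-disjoint cycles, possibly using parallel edges as 2-cycles) with at most ⌊n/6 + 2/3⌋ cycles. -/
/-- Membership in the perfect matching polytope (Edmonds' description). -/
structure InP {V : Type} [Fintype V] [DecidableEq V] (x : V → V → ℝ) : Prop where
  nonneg : ∀ u v, 0 ≤ x u v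
  symm : ∀ u v, x u v = x v u
  diag : ∀ u, x u u = 0
  row : ∀ u, ∑ v, x u v = 1
  odd : ∀ S : Finset V, Odd S.card → 1 ≤ ∑ a ∈ S, ∑ b ∈ Sᶜ, x a b

/-- `σ` is a perfect matching inside the support of `x`. -/
structure IsM {V : Type} (x : V → V → ℝ) (σ : V → V) : Prop where
  inv : ∀ v, σ (σ v) = v
  pos : ∀ v, 0 < x v (σ v)

theorem InP.exists_matching {V : Type} [Fintype V] [DecidableEq V] {x : V → V → ℝ}
    (hx : InP x) : ∃ σ, IsM x σ := by
  classical
  let G : SimpleGraph V :=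
    { Adj := fun u v => 0 < x u v
      symm := ⟨fun u v h => by rw [hx.symm]; exact h⟩
      loopless := ⟨fun u h => by simp [hx.diag] at h⟩ }
  have hT : ∀ u, ¬ G.IsTutteViolator u := by
    intro u hu
    unfold SimpleGraph.IsTutteViolator at hu
    set H := ((⊤ : G.Subgraph).deleteVerts u).coe with hH
    let Kf : H.ConnectedComponent → Finset V := fun K =>
      Finset.univ.filter fun v => ∃ h : v ∈ ((⊤ : G.Subgraph).deleteVerts u).verts,
        H.connectedComponentMk ⟨v, h⟩ = K
    have hcard : ∀ K : H.ConnectedComponent, (Kf K).card = K.supp.ncard := by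
      intro K
      rw [← Set.ncard_image_of_injective K.supp Subtype.val_injective, ← Set.ncard_coe_finset]
      congr 1
      ext v
      simp [Kf]
    have hdisj : ∀ K K', K ≠ K' → Disjoint (Kf K) (Kf K') := by
      intro K K' hne
      rw [Finset.disjoint_left]
      intro v h1 h2
      simp only [Kf, Finset.mem_filter] at h1 h2
      obtain ⟨_, h, rfl⟩ := h1
      obtain ⟨_, h', rfl⟩ := h2
      exact hne rfl
    have hcut : ∀ K ∈ H.oddComponents, 1 ≤ ∑ a ∈ Kf K, ∑ b ∈ u.toFinset, x a b := by
      intro K hK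
      have h1 := hx.odd (Kf K) (by rw [hcard]; exact hK)
      refine h1.trans (Finset.sum_le_sum fun a ha => ?_)
      have : ∑ b ∈ (Kf K)ᶜ, x a b = ∑ b ∈ (Kf K)ᶜ ∩ u.toFinset, x a b := by
        symm
        apply Finset.sum_subset Finset.inter_subset_left
        intro b hb hb'
        by_contra hne
        have hpos : 0 < x a b := lt_of_le_of_ne (hx.nonneg _ _) (Ne.symm hne)
        simp only [Finset.mem_compl] at hb
        have hbu : b ∉ u := fun h => hb' (by simp [hb, h])
        apply hb
        simp only [Kf, Finset.mem_filter, Finset.mem_univ, true_and] at ha ⊢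
        obtain ⟨hau, rfl⟩ := ha
        refine ⟨by simp [hbu], ?_⟩
        rw [SimpleGraph.ConnectedComponent.eq]
        apply SimpleGraph.Adj.reachable
        have hau' : a ∉ u := by simpa using hau
        rw [hH]
        simp [hau', hbu]
        show 0 < x b a
        rw [hx.symm]; exact hpos
      rw [this]
      exact Finset.sum_le_sum_of_subset_of_nonneg Finset.inter_subset_right
        (fun _ _ _ => hx.nonneg _ _)
    have h2 : (H.oddComponents.ncard : ℝ) ≤ u.ncard := by
      calc (H.oddComponents.ncard : ℝ) = ∑ K ∈ H.oddComponents.toFinset, (1:ℝ) := by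
            rw [Set.ncard_eq_toFinset_card']; simp
        _ ≤ ∑ K ∈ H.oddComponents.toFinset, ∑ a ∈ Kf K, ∑ b ∈ u.toFinset, x a b :=
            Finset.sum_le_sum fun K hK => hcut K (by simpa using hK)
        _ = ∑ a ∈ H.oddComponents.toFinset.biUnion Kf, ∑ b ∈ u.toFinset, x a b := by
            rw [Finset.sum_biUnion]
            intro K _ K' _ h
            exact hdisj K K' h
        _ ≤ ∑ a, ∑ b ∈ u.toFinset, x a b :=
            Finset.sum_le_sum_of_subset_of_nonneg (Finset.subset_univ _)
              (fun _ _ _ => Finset.sum_nonneg fun _ _ => hx.nonneg _ _)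
        _ = ∑ b ∈ u.toFinset, ∑ a, x b a := by
            rw [Finset.sum_comm]
            exact Finset.sum_congr rfl fun b _ => Finset.sum_congr rfl fun a _ => hx.symm _ _
        _ = u.ncard := by
            rw [Finset.sum_congr rfl fun b _ => hx.row b, Set.ncard_eq_toFinset_card']; simp
    have h3 : H.oddComponents.ncard ≤ u.ncard := by exact_mod_cast h2
    omega
  obtain ⟨M, hM⟩ := SimpleGraph.tutte.mpr hT
  have h := fun v => hM.1 (hM.2 v)
  choose σ h1 h2 using h
  refine ⟨σ, fun v => ?_, fun v => M.adj_sub (h1 v)⟩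
  exact (h2 _ _ (h1 v).symm).symm

theorem exists_step {J : Type} [Fintype J] (p q : J → ℝ) (hp : ∀ j, 0 < p j)
    (hq : ∃ j, q j < 0) :
    ∃ t, 0 < t ∧ (∀ j, 0 ≤ p j + t * q j) ∧ ∃ j, p j + t * q j = 0 := by
  classical
  obtain ⟨j, hj, hmin⟩ := Finset.exists_min_image (Finset.univ.filter fun j => q j < 0)
    (fun j => p j / (- q j)) (by obtain ⟨j, hj⟩ := hq; exact ⟨j, by simp [hj]⟩)
  simp only [Finset.mem_filter, Finset.mem_univ, true_and] at hj hmin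
  have ht : 0 < p j / (- q j) := div_pos (hp j) (by linarith)
  refine ⟨_, ht, fun k => ?_, j, ?_⟩
  · by_cases hk : q k < 0
    · have := hmin k hk
      rw [le_div_iff₀ (by linarith)] at this
      linarith
    · have := mul_nonneg ht.le (not_lt.mp hk)
      linarith [hp k]
  · have : q j ≠ 0 := hj.ne
    field_simp
    ring

/-- Contraction of the complement of `S` to a single vertex `none`. -/
noncomputable def contr {V : Type} [Fintype V] [DecidableEq V] (S : Finset V)
    (x : V → V → ℝ) : Option {v // v ∈ S} → Option {v // v ∈ S} → ℝ
  | some a, some b => x a b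
  | some a, none => ∑ b ∈ Sᶜ, x a b
  | none, some a => ∑ b ∈ Sᶜ, x a b
  | none, none => 0

theorem InP.even_card {V : Type} [Fintype V] [DecidableEq V] {x : V → V → ℝ}
    (hx : InP x) : Even (Fintype.card V) := by
  by_contra h
  rw [Nat.not_even_iff_odd] at h
  have := hx.odd Finset.univ (by simpa using h)
  simp at this
  linarith

theorem cut_compl {V : Type} [Fintype V] [DecidableEq V] {x : V → V → ℝ}
    (hs : ∀ u v, x u v = x v u) (S : Finset V) :
    ∑ a ∈ Sᶜ, ∑ b ∈ Sᶜᶜ, x a b = ∑ a ∈ S, ∑ b ∈ Sᶜ, x a b := by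
  rw [compl_compl, Finset.sum_comm]
  exact Finset.sum_congr rfl fun b _ => Finset.sum_congr rfl fun a _ => hs _ _

theorem InP.contr {V : Type} [Fintype V] [DecidableEq V] {x : V → V → ℝ}
    (hx : InP x) (S : Finset V) (hS : Odd S.card)
    (ht : ∑ a ∈ S, ∑ b ∈ Sᶜ, x a b = 1) : InP (contr S x) := by
  have hsymm : ∀ u v, _root_.contr S x u v = _root_.contr S x v u := by
    rintro (_ | u) (_ | v) <;> simp [_root_.contr]
    exact hx.symm _ _
  have key : ∀ T : Finset (Option {v // v ∈ S}), none ∉ T → Odd T.card →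
      1 ≤ ∑ a ∈ T, ∑ b ∈ Tᶜ, _root_.contr S x a b := by
    intro T hT hodd
    let T' : Finset V := Finset.univ.filter fun v => ∃ h : v ∈ S, some ⟨v, h⟩ ∈ T
    have hsub : ∀ v ∈ T', v ∈ S := by
      intro v hv
      obtain ⟨h, _⟩ := (Finset.mem_filter.mp hv).2
      exact h
    have hTm : ∀ v : {v // v ∈ S}, some v ∈ T ↔ v.1 ∈ T' := by
      intro v; simp [T']
    have hTT : T = T'.attach.image (fun v => some ⟨v.1, hsub v.1 v.2⟩) := by
      ext y
      rcases y with _ | y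
      · simp [hT]
      · rw [hTm]
        simp only [Finset.mem_image, Finset.mem_attach, true_and, Option.some.injEq]
        constructor
        · intro h; exact ⟨⟨y, h⟩, rfl⟩
        · rintro ⟨a, rfl⟩; exact a.2
    have hinj : Function.Injective (fun v : {v // v ∈ T'} =>
        (some ⟨v.1, hsub v.1 v.2⟩ : Option {v // v ∈ S})) := by
      intro a b h
      have h' := congrArg Subtype.val (Option.some.inj h)
      exact Subtype.ext h'
    have hc : T.card = T'.card := by
      rw [hTT, Finset.card_image_of_injective _ hinj, Finset.card_attach]
    have h1 := hx.odd T' (hc ▸ hodd)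
    refine h1.trans (le_of_eq ?_)
    -- rows
    have hrow : ∀ v : {v // v ∈ S}, ∑ b ∈ Tᶜ, _root_.contr S x (some v) b
        = ∑ b ∈ T'ᶜ, x v b := by
      intro v
      have e1 : ∑ b ∈ Tᶜ, _root_.contr S x (some v) b
          = ∑ b, if b ∈ T then 0 else _root_.contr S x (some v) b := by
        rw [← Finset.sum_filter_add_sum_filter_not Finset.univ (fun b => b ∈ T)
          (fun b => if b ∈ T then 0 else _root_.contr S x (some v) b)]
        rw [Finset.sum_eq_zero (s := Finset.univ.filter fun b => b ∈ T)]
        · rw [zero_add]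
          apply Finset.sum_congr
          · ext; simp
          · intro b hb
            simp at hb
            simp [hb]
        · intro b hb; simp at hb; simp [hb]
      rw [e1, Fintype.sum_option]
      simp only [hT, if_false, _root_.contr]
      have e2 : ∑ b ∈ T'ᶜ, x v b = ∑ b ∈ Sᶜ, x v b + ∑ b ∈ S, if b ∈ T' then 0 else x v b := by
        have : T'ᶜ = Sᶜ ∪ (S.filter fun b => b ∉ T') := by
          ext b; simp only [Finset.mem_compl, Finset.mem_union, Finset.mem_filter]
          have := hsub b
          tauto
        rw [this, Finset.sum_union, Finset.sum_filter]
        · congr 1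
          exact Finset.sum_congr rfl fun b _ => by split_ifs <;> simp_all
        · rw [Finset.disjoint_left]; intro b; simp; tauto
      rw [e2, ← Finset.sum_coe_sort S]
      congr 1
      exact Finset.sum_congr rfl fun b _ => by simp only [hTm]
    conv_rhs => rw [hTT, Finset.sum_image (fun a _ b _ h => hinj h), ← hTT]
    rw [← Finset.sum_attach T']
    exact Finset.sum_congr rfl fun v _ => (hrow ⟨v.1, hsub v.1 v.2⟩).symm
  refine ⟨?_, hsymm, ?_, ?_, ?_⟩
  · rintro (_ | u) (_ | v) <;> simp [_root_.contr]
    · exact Finset.sum_nonneg fun _ _ => hx.nonneg _ _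
    · exact Finset.sum_nonneg fun _ _ => hx.nonneg _ _
    · exact hx.nonneg _ _
  · rintro (_ | u) <;> simp [_root_.contr]
    exact hx.diag _
  · rintro (_ | u)
    · rw [Fintype.sum_option]
      simp only [_root_.contr, zero_add]
      rw [Finset.sum_coe_sort S (fun a => ∑ b ∈ Sᶜ, x a b)]
      exact ht
    · rw [Fintype.sum_option]
      simp only [_root_.contr]
      rw [Finset.sum_coe_sort S (fun b => x u b), add_comm, Finset.sum_add_sum_compl]
      exact hx.row _
  · intro T hodd
    by_cases hT : none ∈ T
    · have h1 := key Tᶜ (by simpa using hT) ?_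
      · rwa [cut_compl hsymm] at h1
      · rw [Finset.card_compl]
        have : Fintype.card (Option {v // v ∈ S}) = S.card + 1 := by simp
        rw [this]
        have h2 : T.card ≤ S.card + 1 := this ▸ Finset.card_le_univ T
        rw [Nat.odd_sub h2]
        have h3 : Even (S.card + 1) := hS.add_one
        have h4 : ¬ Odd (S.card + 1) := by rwa [Nat.not_odd_iff_even]
        have h5 : ¬ Even T.card := by rwa [Nat.not_even_iff_odd]
        tauto
    · exact key T hT hodd

/-- The weighted matching property for all graphs on the vertex type `V`. -/
def Edm (V : Type) [Fintype V] [DecidableEq V] : Prop :=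
  ∀ (x w : V → V → ℝ), InP x →
    ∃ σ, IsM x σ ∧ ∑ v, w v (σ v) ≤ ∑ u, ∑ v, w u v * x u v

/-- Weights inside `S`, zero on edges at the contracted vertex. -/
def wIn {V : Type} {p : V → Prop} (w : V → V → ℝ) (g : {v // p v} → ℝ) :
    Option {v // p v} → Option {v // p v} → ℝ
  | some a, some b => w a b
  | none, some a => g a
  | some _, none => 0
  | none, none => 0

theorem wIn_none_some {V : Type} {p : V → Prop} (w : V → V → ℝ) (g : {v // p v} → ℝ) (a) :
    wIn w g none (some a) = g a := rfl

theorem wIn_sum {V : Type} [Fintype V] [DecidableEq V] (S : Finset V) (x w : V → V → ℝ)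
    (g : {v // v ∈ S} → ℝ) :
    ∑ u, ∑ v, wIn w g u v * contr S x u v
      = ∑ a ∈ S, ∑ b ∈ S, w a b * x a b + ∑ a : {v // v ∈ S}, g a * ∑ b ∈ Sᶜ, x a b := by
  simp only [Fintype.sum_option, wIn, contr, zero_mul, zero_add]
  rw [add_comm, ← Finset.sum_coe_sort S]
  congr 1
  exact Finset.sum_congr rfl fun a _ => Finset.sum_coe_sort S (fun b => w a b * x a b)

theorem wIn_split {V : Type} {p : V → Prop} [Fintype {v // p v}] (w : V → V → ℝ)
    (g : {v // p v} → ℝ) (τ : Option {v // p v} → Option {v // p v}) :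
    ∑ u, wIn w g u (τ u) = wIn w g none (τ none) + ∑ u, wIn w 0 u (τ u) := by
  simp only [Fintype.sum_option]
  have h0 : wIn w (0 : {v // p v} → ℝ) none (τ none) = 0 := by
    rcases τ none with _ | _ <;> simp [wIn]
  rw [h0, zero_add]
  congr 1
  refine Finset.sum_congr rfl fun a _ => ?_
  rcases τ (some a) with _ | _ <;> simp [wIn]

theorem IsM.none_some {V : Type} [Fintype V] [DecidableEq V] {S : Finset V} {x : V → V → ℝ}
    {τ : Option {v // v ∈ S} → Option {v // v ∈ S}} (h : IsM (contr S x) τ) :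
    ∃ a, τ none = some a := by
  rcases hh : τ none with _ | a
  · have := h.pos none
    rw [hh] at this
    simp [contr] at this
  · exact ⟨a, rfl⟩

theorem IsM.none_iff {V : Type} {p : V → Prop} {y : Option {v // p v} → Option {v // p v} → ℝ}
    {τ : Option {v // p v} → Option {v // p v}} (h : IsM y τ) {a : {v // p v}}
    (ha : τ none = some a) (v) : τ (some v) = none ↔ v = a := by
  constructor
  · intro hv
    have := h.inv (some v)
    rw [hv, ha] at this
    simpa using this.symm
  · rintro rfl
    rw [← ha, h.inv]

/-- half of the glued matching -/
def half {V : Type} {S : Finset V} (τ : Option {v // v ∈ S} → Option {v // v ∈ S})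
    (b : V) (v : {v // v ∈ S}) : V := (τ (some v)).elim b Subtype.val

theorem half_sum {V : Type} [Fintype V] [DecidableEq V] {S : Finset V} {x w : V → V → ℝ}
    {τ : Option {v // v ∈ S} → Option {v // v ∈ S}} (h : IsM (contr S x) τ) {a}
    (ha : τ none = some a) (b : V) :
    ∑ v : {v // v ∈ S}, w v (half τ b v) = w a b + ∑ u, wIn w 0 u (τ u) := by
  rw [Fintype.sum_option, ha]
  simp only [wIn_none_some, Pi.zero_apply, zero_add]
  have : ∀ v : {v // v ∈ S}, w v (half τ b v) = (if v = a then w a b else 0) + wIn w 0 (some v) (τ (some v)) := by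
    intro v
    by_cases hv : v = a
    · subst hv
      have := (h.none_iff ha v).mpr rfl
      simp [half, this, wIn]
    · have h1 : τ (some v) ≠ none := fun h' => hv ((h.none_iff ha v).mp h')
      obtain ⟨c, hc⟩ := Option.ne_none_iff_exists'.mp h1
      simp [half, hc, wIn, hv]
  simp only [this, Finset.sum_add_distrib]
  simp

theorem glue_sigma {V : Type} [Fintype V] [DecidableEq V] {x : V → V → ℝ} (hx : InP x)
    {S : Finset V}
    {τ : Option {v // v ∈ S} → Option {v // v ∈ S}} (h : IsM (contr S x) τ) {a}
    (ha : τ none = some a)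
    {τ' : Option {v // v ∈ Sᶜ} → Option {v // v ∈ Sᶜ}} (h' : IsM (contr Sᶜ x) τ') {b}
    (hb : τ' none = some b) (hab : 0 < x a b) :
    ∃ σ, IsM x σ ∧ ∀ w : V → V → ℝ, ∑ v, w v (σ v) = (w a b + ∑ u, wIn w 0 u (τ u)) +
      (w b a + ∑ u, wIn w 0 u (τ' u)) := by
  let σ : V → V := fun v => if hv : v ∈ S then half τ b ⟨v, hv⟩ else
    half τ' a ⟨v, Finset.mem_compl.mpr hv⟩
  have s1 : ∀ v : {v // v ∈ S}, σ v = half τ b v := by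
    intro v; simp [σ]
  have s2 : ∀ v : {v // v ∈ Sᶜ}, σ v = half τ' a v := by
    intro v
    have : v.1 ∉ S := Finset.mem_compl.mp v.2
    simp [σ, this]
  have a1 : τ (some a) = none := (h.none_iff ha a).mpr rfl
  have b1 : τ' (some b) = none := (h'.none_iff hb b).mpr rfl
  have sa : σ a = b := by rw [s1]; simp [half, a1]
  have sb : σ b = a := by rw [s2]; simp [half, b1]
  have k1 : ∀ v : {v // v ∈ S}, σ (σ v) = v ∧ 0 < x v (σ v) := by
    intro v
    by_cases hv : v = a
    · subst hv; rw [sa, sb]; exact ⟨rfl, hab⟩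
    · have h1 : τ (some v) ≠ none := fun h' => hv ((h.none_iff ha v).mp h')
      obtain ⟨c, hc⟩ := Option.ne_none_iff_exists'.mp h1
      have hc' : τ (some c) = some v := by rw [← hc, h.inv]
      have e : σ v = c := by rw [s1]; simp [half, hc]
      refine ⟨?_, ?_⟩
      · rw [e, s1]; simp [half, hc']
      · rw [e]
        have := h.pos (some v)
        rw [hc] at this
        exact this
  have k2 : ∀ v : {v // v ∈ Sᶜ}, σ (σ v) = v ∧ 0 < x v (σ v) := by
    intro v
    by_cases hv : v = b
    · subst hv; rw [sb, sa, hx.symm]; exact ⟨rfl, hab⟩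
    · have h1 : τ' (some v) ≠ none := fun h'' => hv ((h'.none_iff hb v).mp h'')
      obtain ⟨c, hc⟩ := Option.ne_none_iff_exists'.mp h1
      have hc' : τ' (some c) = some v := by rw [← hc, h'.inv]
      have e : σ v = c := by rw [s2]; simp [half, hc]
      refine ⟨?_, ?_⟩
      · rw [e, s2]; simp [half, hc']
      · rw [e]
        have := h'.pos (some v)
        rw [hc] at this
        exact this
  have k : ∀ v, σ (σ v) = v ∧ 0 < x v (σ v) := by
    intro v
    by_cases hv : v ∈ S
    · exact k1 ⟨v, hv⟩
    · exact k2 ⟨v, Finset.mem_compl.mpr hv⟩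
  refine ⟨σ, ⟨fun v => (k v).1, fun v => (k v).2⟩, fun w => ?_⟩
  rw [← half_sum h ha b, ← half_sum h' hb a, ← Finset.sum_add_sum_compl S]
  congr 1
  · rw [← Finset.sum_coe_sort]
    refine Finset.sum_congr rfl fun v _ => ?_
    rw [s1]
  · rw [← Finset.sum_coe_sort]
    refine Finset.sum_congr rfl fun v _ => ?_
    rw [s2]

theorem glue {V : Type} [Fintype V] [DecidableEq V] {x : V → V → ℝ} (hx : InP x)
    (w : V → V → ℝ) (S : Finset V) (hS : Odd S.card)
    (ht : ∑ a ∈ S, ∑ b ∈ Sᶜ, x a b = 1)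
    (E1 : Edm (Option {v // v ∈ S})) (E2 : Edm (Option {v // v ∈ Sᶜ})) :
    ∃ σ, IsM x σ ∧ ∑ v, w v (σ v) ≤ ∑ u, ∑ v, w u v * x u v := by
  classical
  have hSc : Odd Sᶜ.card := by
    rw [Finset.card_compl, Nat.odd_sub (Finset.card_le_univ S)]
    have h1 := hx.even_card
    have h2 : ¬ Odd (Fintype.card V) := by rwa [Nat.not_odd_iff_even]
    have h3 : ¬ Even S.card := by rwa [Nat.not_even_iff_odd]
    tauto
  have P1 := hx.contr S hS ht
  have P2 := hx.contr Sᶜ hSc (by rw [cut_compl hx.symm]; exact ht)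
  -- best completions on the complement side
  have hf : ∀ b : {v // v ∈ Sᶜ}, ∃ fb : ℝ, 0 < contr Sᶜ x none (some b) →
      (∃ τ, IsM (contr Sᶜ x) τ ∧ τ none = some b ∧ ∑ u, wIn w 0 u (τ u) = fb) ∧
      ∀ τ, IsM (contr Sᶜ x) τ → τ none = some b → fb ≤ ∑ u, wIn w 0 u (τ u) := by
    intro b
    by_cases hb : 0 < contr Sᶜ x none (some b)
    swap
    · exact ⟨0, fun h => absurd h hb⟩
    obtain ⟨τ, hτ, hle⟩ := E2 _ (wIn 0 (fun c => if c = b then -1 else 0)) P2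
    have hτb : τ none = some b := by
      obtain ⟨c, hc⟩ := hτ.none_some
      rw [wIn_split, wIn_sum, hc] at hle
      have z : ∑ u, wIn (0 : V → V → ℝ) 0 u (τ u) = 0 := by
        apply Finset.sum_eq_zero
        intro u _
        rcases u with _ | u <;> rcases τ _ with _ | _ <;> simp [wIn]
      rw [z] at hle
      simp only [wIn, Pi.zero_apply, zero_mul, Finset.sum_const_zero, ite_mul, neg_mul, one_mul,
        Finset.sum_ite_eq', Finset.mem_univ, if_true] at hle
      simp only [contr] at hb
      by_cases hcb : c = b
      · rw [hc, hcb]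
      · rw [if_neg hcb] at hle
        linarith
    obtain ⟨τ₀, h0, hmin⟩ := Finset.exists_min_image
      (Finset.univ.filter fun τ => IsM (contr Sᶜ x) τ ∧ τ none = some b)
      (fun τ => ∑ u, wIn w 0 u (τ u)) ⟨τ, by simp [hτ, hτb]⟩
    simp only [Finset.mem_filter, Finset.mem_univ, true_and] at h0 hmin
    exact ⟨_, fun _ => ⟨⟨τ₀, h0.1, h0.2, rfl⟩, fun τ h1 h2 => hmin τ ⟨h1, h2⟩⟩⟩
  choose f hf using hf
  -- complement side inequality
  have I2 : ∑ b : {v // v ∈ Sᶜ}, f b * ∑ a ∈ S, x b a ≤ ∑ a ∈ Sᶜ, ∑ b ∈ Sᶜ, w a b * x a b := by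
    obtain ⟨τ, hτ, hle⟩ := E2 _ (wIn w (fun b => - f b)) P2
    obtain ⟨c, hc⟩ := hτ.none_some
    rw [wIn_split, wIn_sum, hc] at hle
    have hp := hτ.pos none
    rw [hc] at hp
    have := (hf c hp).2 τ hτ hc
    simp only [wIn_none_some, compl_compl, neg_mul, Finset.sum_neg_distrib] at hle
    linarith
  let g : V → V → ℝ := fun a b => w a b + w b a + if hb : b ∈ Sᶜ then f ⟨b, hb⟩ else 0
  let av : {v // v ∈ S} → ℝ := fun a => (∑ b ∈ Sᶜ, g a b * x a b) / ∑ b ∈ Sᶜ, x a b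
  obtain ⟨τ, hτ, hle⟩ := E1 _ (wIn w av) P1
  obtain ⟨a, ha⟩ := hτ.none_some
  rw [wIn_split, wIn_sum, ha] at hle
  simp only [wIn_none_some] at hle
  have hav : ∀ a, av a * ∑ b ∈ Sᶜ, x a b = ∑ b ∈ Sᶜ, g a b * x a b := by
    intro a
    by_cases h0 : ∑ b ∈ Sᶜ, x a b = 0
    · rw [h0, mul_zero]
      symm
      apply Finset.sum_eq_zero
      intro b hb
      rw [(Finset.sum_eq_zero_iff_of_nonneg (fun b _ => hx.nonneg _ _)).mp h0 b hb, mul_zero]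
    · exact div_mul_cancel₀ _ h0
  have hpa := hτ.pos none
  rw [ha] at hpa
  simp only [contr] at hpa
  have hb : ∃ b : {v // v ∈ Sᶜ}, 0 < x a b ∧ g a b ≤ av a := by
    by_contra! hcon
    have h1 : ∑ b ∈ Sᶜ, av a * x a b < ∑ b ∈ Sᶜ, g a b * x a b := by
      apply Finset.sum_lt_sum
      · intro b hb
        rcases (hx.nonneg a b).eq_or_lt with h | h
        · rw [← h]; simp
        · exact mul_le_mul_of_nonneg_right (hcon ⟨b, hb⟩ h).le h.le
      · obtain ⟨b, hb, hpos⟩ := Finset.exists_lt_of_sum_lt (s := Sᶜ) (f := fun _ => (0:ℝ))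
          (g := fun b => x a b) (by simpa using hpa)
        exact ⟨b, hb, mul_lt_mul_of_pos_right (hcon ⟨b, hb⟩ hpos) hpos⟩
    rw [← Finset.mul_sum, hav] at h1
    exact lt_irrefl _ h1
  obtain ⟨b, hab, hgb⟩ := hb
  have hpb : 0 < contr Sᶜ x none (some b) := by
    simp only [contr, compl_compl]
    refine lt_of_lt_of_le hab ?_
    rw [hx.symm]
    exact Finset.single_le_sum (f := fun c => x b c) (fun c _ => hx.nonneg _ _) a.2
  obtain ⟨⟨τ', hτ', hb', hfb⟩, -⟩ := hf b hpb
  obtain ⟨σ, hσ, hw⟩ := glue_sigma hx hτ ha hτ' hb' hab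
  refine ⟨σ, hσ, ?_⟩
  rw [hw, hfb]
  simp only [hav] at hle
  have hgab : g a b = w a b + w b a + f b := by
    have := Finset.mem_compl.mp b.2
    simp [g, this]
  rw [hgab] at hgb
  have t1 : ∑ a : {v // v ∈ S}, ∑ b ∈ Sᶜ, g a b * x a b =
      ∑ a ∈ S, ∑ b ∈ Sᶜ, w a b * x a b + ∑ a ∈ Sᶜ, ∑ b ∈ S, w a b * x a b
      + ∑ b : {v // v ∈ Sᶜ}, f b * ∑ a ∈ S, x b a := by
    rw [Finset.sum_coe_sort S (fun a => ∑ b ∈ Sᶜ, g a b * x a b)]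
    have e3 : ∑ b : {v // v ∈ Sᶜ}, f b * ∑ a ∈ S, x b a
        = ∑ b ∈ Sᶜ, ∑ a ∈ S, (if hb : b ∈ Sᶜ then f ⟨b, hb⟩ else 0) * x b a := by
      rw [← Finset.sum_coe_sort Sᶜ]
      refine Finset.sum_congr rfl fun b _ => ?_
      rw [Finset.mul_sum]
      simp only [b.2, dif_pos]
    rw [e3, Finset.sum_comm (s := Sᶜ) (t := S), Finset.sum_comm (s := Sᶜ) (t := S),
      ← Finset.sum_add_distrib, ← Finset.sum_add_distrib]
    refine Finset.sum_congr rfl fun a _ => ?_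
    rw [← Finset.sum_add_distrib, ← Finset.sum_add_distrib]
    refine Finset.sum_congr rfl fun b _ => ?_
    rw [hx.symm b a]
    simp only [g]
    ring
  have t2 : ∑ u, ∑ v, w u v * x u v = ∑ a ∈ S, ∑ b ∈ S, w a b * x a b +
      ∑ a ∈ S, ∑ b ∈ Sᶜ, w a b * x a b + (∑ a ∈ Sᶜ, ∑ b ∈ S, w a b * x a b +
      ∑ a ∈ Sᶜ, ∑ b ∈ Sᶜ, w a b * x a b) := by
    rw [← Finset.sum_add_sum_compl S, ← Finset.sum_add_distrib, ← Finset.sum_add_distrib]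
    congr 1 <;> exact Finset.sum_congr rfl fun a _ => (Finset.sum_add_sum_compl S _).symm
  rw [t1] at hle
  rw [t2]
  linarith

theorem edmonds_aux (n : ℕ) : ∀ (V : Type) [Fintype V] [DecidableEq V],
    Fintype.card V = n → Edm V := by
  induction n using Nat.strong_induction_on with
  | _ n IH =>
  intro V _ _ hn
  have hglue : ∀ (x w : V → V → ℝ), InP x → ∀ S : Finset V, Odd S.card → S.card ≠ 1 →
      Sᶜ.card ≠ 1 → ∑ a ∈ S, ∑ b ∈ Sᶜ, x a b = 1 →
      ∃ σ, IsM x σ ∧ ∑ v, w v (σ v) ≤ ∑ u, ∑ v, w u v * x u v := by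
    intro x w hx S hS h1 h2 ht
    have h0 : Sᶜ.card ≠ 0 := by
      intro h
      have : Sᶜ = ∅ := Finset.card_eq_zero.mp h
      rw [this] at ht
      simp at ht
    have h3 : S.card ≠ 0 := by
      intro h
      rw [h] at hS
      simp at hS
    have h4 := Finset.card_add_card_compl S
    refine glue hx w S hS ht (IH (S.card + 1) (by omega) _ (by simp))
      (IH (Sᶜ.card + 1) (by omega) _ ?_)
    rw [Fintype.card_option, Fintype.card_coe]
  suffices H : ∀ (k : ℕ) (x w : V → V → ℝ), InP x →
      (Finset.univ.filter fun e : V × V => 0 < x e.1 e.2).card = k →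
      ∃ σ, IsM x σ ∧ ∑ v, w v (σ v) ≤ ∑ u, ∑ v, w u v * x u v by
    intro x w hx
    exact H _ x w hx rfl
  intro k
  induction k using Nat.strong_induction_on with
  | _ k IHk =>
  intro x w hx hk
  by_cases htight : ∃ S : Finset V, Odd S.card ∧ S.card ≠ 1 ∧ Sᶜ.card ≠ 1 ∧
      ∑ a ∈ S, ∑ b ∈ Sᶜ, x a b = 1
  · obtain ⟨S, h1, h2, h3, h4⟩ := htight
    exact hglue x w hx S h1 h2 h3 h4
  push Not at htight
  obtain ⟨σ, hσ⟩ := hx.exists_matching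
  by_cases hw : ∑ v, w v (σ v) ≤ ∑ u, ∑ v, w u v * x u v
  · exact ⟨σ, hσ, hw⟩
  push Not at hw
  let m : V → V → ℝ := fun u v => if σ u = v then 1 else 0
  have hwm : ∑ u, ∑ v, w u v * m u v = ∑ v, w v (σ v) := by
    refine Finset.sum_congr rfl fun u _ => ?_
    simp [m]
  have hmrow : ∀ u, ∑ v, m u v = 1 := by intro u; simp [m]
  have hmsymm : ∀ u v, m u v = m v u := by
    intro u v
    have : σ u = v ↔ σ v = u := by
      constructor
      · rintro rfl; exact hσ.inv u
      · rintro rfl; exact hσ.inv v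
    simp [m, this]
  have hm0 : ∀ u v, x u v = 0 → m u v = 0 := by
    intro u v h
    have : σ u ≠ v := by
      rintro rfl
      exact (hσ.pos u).ne' h
    simp [m, this]
  let cut : (V → V → ℝ) → Finset V → ℝ := fun y S => ∑ a ∈ S, ∑ b ∈ Sᶜ, y a b
  let J := {e : V × V // 0 < x e.1 e.2} ⊕
    {S : Finset V // Odd S.card ∧ S.card ≠ 1 ∧ Sᶜ.card ≠ 1}
  have : Fintype J := by classical exact inferInstance
  obtain ⟨t, ht, hall, j, hj⟩ := exists_step (J := J)
    (Sum.elim (fun e => x e.1.1 e.1.2) (fun S => cut x S.1 - 1))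
    (Sum.elim (fun e => x e.1.1 e.1.2 - m e.1.1 e.1.2) (fun S => cut x S.1 - cut m S.1))
    (by
      rintro (e | S)
      · exact e.2
      · have h1 := hx.odd S.1 S.2.1
        have h2 := htight S.1 S.2.1 S.2.2.1 S.2.2.2
        have : 1 < cut x S.1 := lt_of_le_of_ne h1 (Ne.symm h2)
        simpa using this)
    (by
      by_contra! hcon
      have hge : ∀ u v, m u v ≤ x u v := by
        intro u v
        by_cases h : 0 < x u v
        · have := hcon (Sum.inl ⟨(u, v), h⟩)
          simpa using this
        · have h0 : x u v = 0 := le_antisymm (not_lt.mp h) (hx.nonneg _ _)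
          rw [hm0 u v h0, h0]
      have heq : ∀ u v, m u v = x u v := by
        intro u v
        have := (Finset.sum_eq_sum_iff_of_le (s := Finset.univ) (f := fun v => m u v)
          (g := fun v => x u v) (fun v _ => hge u v)).mp (by rw [hmrow, hx.row])
        exact this v (Finset.mem_univ _)
      rw [← hwm] at hw
      simp only [heq] at hw
      exact lt_irrefl _ hw)
  let x' : V → V → ℝ := fun u v => x u v + t * (x u v - m u v)
  have hcut' : ∀ S, cut x' S = cut x S + t * (cut x S - cut m S) := by
    intro S
    simp only [cut, x', Finset.sum_add_distrib, Finset.mul_sum, ← Finset.sum_sub_distrib]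
  have hx0 : ∀ u v, x u v = 0 → x' u v = 0 := by
    intro u v h
    simp [x', h, hm0 u v h]
  have hsymm' : ∀ u v, x' u v = x' v u := by
    intro u v
    simp only [x']
    rw [hx.symm u v, hmsymm u v]
  have hrow' : ∀ u, ∑ v, x' u v = 1 := by
    intro u
    simp only [x', Finset.sum_add_distrib, ← Finset.mul_sum, Finset.sum_sub_distrib, hmrow, hx.row]
    ring
  have hdiag' : ∀ u, x' u u = 0 := fun u => hx0 u u (hx.diag u)
  have hone : ∀ S : Finset V, S.card = 1 → 1 ≤ cut x' S := by
    intro S hS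
    obtain ⟨a, rfl⟩ := Finset.card_eq_one.mp hS
    have h1 := Finset.sum_add_sum_compl {a} (fun b => x' a b)
    rw [hrow', Finset.sum_singleton, hdiag', zero_add] at h1
    simp only [cut, Finset.sum_singleton]
    exact h1.ge
  have hx' : InP x' := by
    refine ⟨?_, hsymm', hdiag', hrow', ?_⟩
    · intro u v
      by_cases h : 0 < x u v
      · exact hall (Sum.inl ⟨(u, v), h⟩)
      · rw [hx0 u v (le_antisymm (not_lt.mp h) (hx.nonneg _ _))]
    · intro S hS
      change 1 ≤ cut x' S
      by_cases h1 : S.card = 1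
      · exact hone S h1
      by_cases h2 : Sᶜ.card = 1
      · have := hone Sᶜ h2
        have e := cut_compl hsymm' S
        change cut x' Sᶜ = cut x' S at e
        rwa [e] at this
      have := hall (Sum.inr ⟨S, hS, h1, h2⟩)
      simp only [Sum.elim_inr] at this
      rw [hcut']
      linarith
  have hwx' : ∑ u, ∑ v, w u v * x' u v ≤ ∑ u, ∑ v, w u v * x u v := by
    have : ∑ u, ∑ v, w u v * x' u v = ∑ u, ∑ v, w u v * x u v +
        t * (∑ u, ∑ v, w u v * x u v - ∑ u, ∑ v, w u v * m u v) := by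
      simp only [← Finset.sum_sub_distrib, Finset.mul_sum, ← Finset.sum_add_distrib]
      refine Finset.sum_congr rfl fun u _ => Finset.sum_congr rfl fun v _ => ?_
      simp only [x']
      ring
    rw [this, hwm]
    nlinarith
  have hfin : ∃ τ, IsM x' τ ∧ ∑ v, w v (τ v) ≤ ∑ u, ∑ v, w u v * x' u v := by
    rcases j with e | S
    · refine IHk _ ?_ x' w hx' rfl
      rw [← hk]
      apply Finset.card_lt_card
      rw [Finset.ssubset_iff_of_subset]
      · refine ⟨e.1, by simpa using e.2, ?_⟩
        have : x' e.1.1 e.1.2 = 0 := hj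
        simp [this]
      · intro f
        simp only [Finset.mem_filter, Finset.mem_univ, true_and]
        intro hf
        refine lt_of_le_of_ne (hx.nonneg _ _) fun h => ?_
        rw [hx0 _ _ h.symm] at hf
        exact lt_irrefl _ hf
    · refine hglue x' w hx' S.1 S.2.1 S.2.2.1 S.2.2.2 ?_
      change cut x' S.1 = 1
      rw [hcut']
      simp only [Sum.elim_inr] at hj
      linarith
  obtain ⟨τ, hτ, hle⟩ := hfin
  refine ⟨τ, ⟨hτ.inv, fun v => ?_⟩, hle.trans hwx'⟩
  refine lt_of_le_of_ne (hx.nonneg _ _) fun h => ?_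
  have := hτ.pos v
  rw [hx0 _ _ h.symm] at this
  exact lt_irrefl _ this

theorem edmonds (V : Type) [Fintype V] [DecidableEq V] : Edm V := edmonds_aux _ V rfl

/-- Number of edges from `A` to `B`. -/
def ee {V : Type} (m : V → V → ℕ) (A B : Finset V) : ℕ := ∑ a ∈ A, ∑ b ∈ B, m a b

theorem ee_symm {V : Type} {m : V → V → ℕ} (hs : ∀ u v, m u v = m v u) (A B : Finset V) :
    ee m A B = ee m B A := by
  unfold ee
  rw [Finset.sum_comm]
  exact Finset.sum_congr rfl fun b _ => Finset.sum_congr rfl fun a _ => hs _ _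

theorem ee_union_right {V : Type} [DecidableEq V] (m : V → V → ℕ) (A B C : Finset V)
    (h : Disjoint B C) : ee m A (B ∪ C) = ee m A B + ee m A C := by
  unfold ee
  rw [← Finset.sum_add_distrib]
  exact Finset.sum_congr rfl fun a _ => Finset.sum_union h

theorem ee_union_left {V : Type} [DecidableEq V] (m : V → V → ℕ) (A B C : Finset V)
    (h : Disjoint A B) : ee m (A ∪ B) C = ee m A C + ee m B C := Finset.sum_union h

theorem ee_pos {V : Type} {m : V → V → ℕ} {A B : Finset V} {a b : V} (ha : a ∈ A) (hb : b ∈ B)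
    (h : 0 < m a b) : 1 ≤ ee m A B :=
  calc 1 ≤ m a b := h
    _ ≤ ∑ b ∈ B, m a b := Finset.single_le_sum (f := fun b => m a b) (fun _ _ => Nat.zero_le _) hb
    _ ≤ _ := Finset.single_le_sum (f := fun a => ∑ b ∈ B, m a b) (fun _ _ => Nat.zero_le _) ha

theorem ee_le {V : Type} {m : V → V → ℕ} {A B : Finset V} {a b : V} (ha : a ∈ A) (hb : b ∈ B) :
    m a b ≤ ee m A B :=
  calc m a b ≤ ∑ b ∈ B, m a b :=
        Finset.single_le_sum (f := fun b => m a b) (fun _ _ => Nat.zero_le _) hb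
    _ ≤ _ := Finset.single_le_sum (f := fun a => ∑ b ∈ B, m a b) (fun _ _ => Nat.zero_le _) ha

theorem ee_zero {V : Type} {m : V → V → ℕ} {A B : Finset V}
    (h : ∀ a ∈ A, ∀ b ∈ B, m a b = 0) : ee m A B = 0 :=
  Finset.sum_eq_zero fun a ha => Finset.sum_eq_zero fun b hb => h a ha b hb

/-- `S` is connected by the relation `r`. -/
def Conn {V : Type} (r : V → V → Prop) (S : Finset V) : Prop :=
  ∀ A : Set V, (∀ a ∈ S, a ∈ A → ∀ b ∈ S, r a b → b ∈ A) → ∀ z ∈ S, z ∈ A → ∀ y ∈ S, y ∈ A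

theorem Conn.mono {V : Type} {r r' : V → V → Prop} {S : Finset V} (h : Conn r S)
    (hr : ∀ a b, r a b → r' a b) : Conn r' S :=
  fun A hA => h A fun a ha haA b hb hab => hA a ha haA b hb (hr a b hab)

theorem Conn.insert {V : Type} [DecidableEq V] {r : V → V → Prop} (hr : ∀ a b, r a b → r b a)
    {T : Finset V} (h : Conn r T) {v b : V} (hb : b ∈ T) (hvb : r v b) : Conn r (insert v T) := by
  intro A hA z hz hzA
  have h1 := h A fun a ha haA b hb hab =>
    hA a (Finset.mem_insert_of_mem ha) haA b (Finset.mem_insert_of_mem hb) hab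
  have key : v ∈ A ∧ ∀ y ∈ T, y ∈ A := by
    rcases Finset.mem_insert.mp hz with rfl | hz
    · have hbA := hA z (Finset.mem_insert_self _ _) hzA b (Finset.mem_insert_of_mem hb) hvb
      exact ⟨hzA, h1 b hb hbA⟩
    · have h2 := h1 z hz hzA
      exact ⟨hA b (Finset.mem_insert_of_mem hb) (h2 b hb) v (Finset.mem_insert_self _ _) (hr _ _ hvb),
        h2⟩
  intro y hy
  rcases Finset.mem_insert.mp hy with rfl | hy
  · exact key.1
  · exact key.2 y hy

theorem Conn.union {V : Type} [DecidableEq V] {r : V → V → Prop}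
    {S T : Finset V} (hS : Conn r S) (hT : Conn r T) {v : V} (h1 : v ∈ S) (h2 : v ∈ T) :
    Conn r (S ∪ T) := by
  intro A hA z hz hzA
  have k1 := hS A fun a ha haA b hb hab =>
    hA a (Finset.mem_union_left _ ha) haA b (Finset.mem_union_left _ hb) hab
  have k2 := hT A fun a ha haA b hb hab =>
    hA a (Finset.mem_union_right _ ha) haA b (Finset.mem_union_right _ hb) hab
  have hv : v ∈ A := by
    rcases Finset.mem_union.mp hz with hz | hz
    · exact k1 z hz hzA v h1
    · exact k2 z hz hzA v h2
  intro y hy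
  rcases Finset.mem_union.mp hy with hy | hy
  · exact k1 v h1 hv y hy
  · exact k2 v h2 hv y hy

/-- Adjacency after deleting the matching `σ` except for edges of `F`. -/
def MRel {V : Type} (m : V → V → ℕ) (σ : V → V) (F : Finset (V × V)) (a b : V) : Prop :=
  2 ≤ m a b ∨ (m a b = 1 ∧ σ a ≠ b) ∨ (a, b) ∈ F ∨ (b, a) ∈ F

theorem MRel.symm {V : Type} {m : V → V → ℕ} (hs : ∀ u v, m u v = m v u) {σ : V → V}
    (hσ : ∀ v, σ (σ v) = v) {F : Finset (V × V)} (a b : V) (h : MRel m σ F a b) :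
    MRel m σ F b a := by
  unfold MRel at *
  rw [hs b a]
  rcases h with h | h | h | h
  · exact Or.inl h
  · refine Or.inr (Or.inl ⟨h.1, fun h' => h.2 ?_⟩)
    rw [← h', hσ]
  · exact Or.inr (Or.inr (Or.inr h))
  · exact Or.inr (Or.inr (Or.inl h))

theorem MRel.mono {V : Type} {m : V → V → ℕ} {σ : V → V} {F F' : Finset (V × V)} (hF : F ⊆ F')
    (a b : V) (h : MRel m σ F a b) : MRel m σ F' a b := by
  rcases h with h | h | h | h
  · exact Or.inl h
  · exact Or.inr (Or.inl h)
  · exact Or.inr (Or.inr (Or.inl (hF h)))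
  · exact Or.inr (Or.inr (Or.inr (hF h)))

theorem MRel.exists {V : Type} [DecidableEq V] {m : V → V → ℕ} (σ : V → V) (F : Finset (V × V))
    (v : V) (T : Finset V) (h : 2 ≤ ee m {v} T) : ∃ b ∈ T, MRel m σ F v b := by
  by_contra! hcon
  have h1 : ∀ b ∈ T, m v b ≤ if σ v = b then 1 else 0 := by
    intro b hb
    have := hcon b hb
    unfold MRel at this
    push Not at this
    split_ifs with h'
    · omega
    · have := this.2.1
      have : m v b ≠ 1 := fun h => h' (this h)
      omega
  have h2 : ee m {v} T ≤ 1 := by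
    unfold ee
    rw [Finset.sum_singleton]
    refine (Finset.sum_le_sum h1).trans ?_
    rw [Finset.sum_ite_eq]
    split_ifs <;> simp
  omega

theorem struct {V : Type} [Fintype V] [DecidableEq V] {m : V → V → ℕ}
    (hs : ∀ u v, m u v = m v u) (hd : ∀ u, m u u = 0) (h3 : ∀ u, ∑ v, m u v = 3) (k : ℕ) :
    ∀ (S : Finset V) (v : V), S.card = k → v ∈ S → Conn (fun a b => 0 < m a b) S →
      (∃ u ∉ S, 0 < m v u) →
      ∃ F : Finset (V × V), (∀ e ∈ F, m e.1 e.2 = 1) ∧ 2 * F.card + 4 ≤ S.card + ee m S Sᶜ ∧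
        ∀ σ : V → V, (∀ v, σ (σ v) = v) → Conn (MRel m σ F) S := by
  induction k using Nat.strong_induction_on with
  | _ k IH =>
  intro S v hk hv hc ⟨u, huS, hvu⟩
  have hun : ∀ A, ee m {v} A + ee m {v} Aᶜ = 3 := by
    intro A
    rw [← ee_union_right _ _ _ _ disjoint_compl_right, Finset.union_compl]
    simp [ee, h3]
  set T := S.erase v with hT
  have hvT : v ∉ T := Finset.notMem_erase v S
  have hST : S = {v} ∪ T := by rw [hT]; ext a; by_cases h : a = v <;> simp [h, hv]
  have hTcard : T.card + 1 = S.card := Finset.card_erase_add_one hv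
  have hTS : T ⊆ S := Finset.erase_subset _ _
  have hdvT : Disjoint {v} T := by simpa using hvT
  have hout : 1 ≤ ee m {v} Sᶜ :=
    ee_pos (Finset.mem_singleton_self v) (Finset.mem_compl.mpr huS) hvu
  have hvv : ee m {v} {v} = 0 := by simp [ee, hd]
  have hvS : ee m {v} S = ee m {v} T := by
    rw [hST, ee_union_right _ _ _ _ hdvT, hvv, zero_add]
  have hsum := hun S
  rw [hvS] at hsum
  have hSS : ee m S Sᶜ = ee m {v} Sᶜ + ee m T Sᶜ := by
    conv_lhs => rw [hST]
    rw [ee_union_left _ _ _ _ hdvT, ← hST]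
  -- pieces with no edge to the rest of T have an edge to v
  have hpiece : ∀ X ⊆ T, X.Nonempty → (∀ a ∈ X, ∀ b ∈ T, b ∉ X → m a b = 0) →
      ∃ b ∈ X, 0 < m v b := by
    intro X hX ⟨z, hz⟩ h0
    by_contra! hcon
    have := hc (X : Set V) ?_ z (hTS (hX hz)) hz v hv
    · exact hvT (hX this)
    · intro a _ haX b hb hab
      by_contra hbX
      by_cases hbv : b = v
      · subst hbv
        have := hcon a haX
        rw [hs] at this
        omega
      · have := h0 a haX b (Finset.mem_erase.mpr ⟨hbv, hb⟩) hbX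
        omega
  have hXX : ∀ X ⊆ T, (∀ a ∈ X, ∀ b ∈ T, b ∉ X → m a b = 0) →
      ee m X Xᶜ = ee m X Sᶜ + ee m {v} X := by
    intro X hX h0
    have e : Xᶜ = (Sᶜ ∪ {v}) ∪ (T \ X) := by
      ext a
      have h1 : a ∈ X → a ∈ T := fun h => hX h
      have h2 : a ∈ S ↔ a = v ∨ a ∈ T := by rw [hST]; simp
      have h4 : a = v → a ∉ T := by rintro rfl; exact hvT
      simp only [Finset.mem_compl, Finset.mem_union, Finset.mem_singleton, Finset.mem_sdiff]
      tauto
    have d1 : Disjoint (Sᶜ ∪ {v}) (T \ X) := by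
      rw [Finset.disjoint_left]
      intro a ha ha'
      have haT := (Finset.mem_sdiff.mp ha').1
      rcases Finset.mem_union.mp ha with h | h
      · exact (Finset.mem_compl.mp h) (hTS haT)
      · rw [Finset.mem_singleton] at h; subst h; exact hvT haT
    have d2 : Disjoint Sᶜ {v} := by simpa using hv
    rw [e, ee_union_right _ _ _ _ d1, ee_union_right _ _ _ _ d2,
      ee_zero (A := X) (B := T \ X), ee_symm hs {v} X, add_zero]
    intro a ha b hb
    exact h0 a ha b (Finset.mem_sdiff.mp hb).1 (Finset.mem_sdiff.mp hb).2
  rcases T.eq_empty_or_nonempty with hTe | hTne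
  · refine ⟨∅, by simp, ?_, ?_⟩
    · rw [hTe] at hsum hTcard
      have : ee m {v} ∅ = 0 := by simp [ee]
      simp at hTcard ⊢
      omega
    · intro σ _ A _ z hz hzA y hy
      rw [hST, hTe] at hz hy
      simp at hz hy
      rw [hy, ← hz]; exact hzA
  by_cases hcT : Conn (fun a b => 0 < m a b) T
  · have hno : ∀ a ∈ T, ∀ b ∈ T, b ∉ T → m a b = 0 := fun a _ b h1 h2 => absurd h1 h2
    obtain ⟨b, hb, hvb⟩ := hpiece T subset_rfl hTne hno
    obtain ⟨F, hF1, hF2, hF3⟩ := IH T.card (by omega) T b rfl hb hcT ⟨v, hvT, by rwa [hs]⟩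
    have hcutT := hXX T subset_rfl hno
    have hpos : 1 ≤ ee m {v} T := ee_pos (Finset.mem_singleton_self v) hb hvb
    have hins : S = insert v T := by rw [hST]; rfl
    by_cases h2 : 2 ≤ ee m {v} T
    · refine ⟨F, hF1, by omega, fun σ hσ => ?_⟩
      obtain ⟨c, hc1, hc2⟩ := MRel.exists σ F v T h2
      rw [hins]
      exact (hF3 σ hσ).insert (MRel.symm hs hσ) hc1 hc2
    · refine ⟨insert (v, b) F, ?_, ?_, fun σ hσ => ?_⟩
      · intro e he
        rcases Finset.mem_insert.mp he with rfl | he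
        · have := ee_le (m := m) (Finset.mem_singleton_self v) hb
          simp only
          omega
        · exact hF1 e he
      · have := Finset.card_insert_le (v, b) F
        omega
      · rw [hins]
        refine ((hF3 σ hσ).mono (MRel.mono (Finset.subset_insert _ _))).insert
          (MRel.symm hs hσ) hb ?_
        exact Or.inr (Or.inr (Or.inl (Finset.mem_insert_self _ _)))
  · -- split
    classical
    unfold Conn at hcT
    push Not at hcT
    obtain ⟨A, hA, z, hzT, hzA, y, hyT, hyA⟩ := hcT
    set T1 := T.filter (fun a => a ∈ A) with hT1
    set T2 := T.filter (fun a => a ∉ A) with hT2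
    have hd12 : Disjoint T1 T2 := Finset.disjoint_filter_filter_not _ _ _
    have hu12 : T = T1 ∪ T2 := (Finset.filter_union_filter_not_eq _ _).symm
    have s1 : T1 ⊆ T := Finset.filter_subset _ _
    have s2 : T2 ⊆ T := Finset.filter_subset _ _
    have hz12 : ∀ a ∈ T1, ∀ b ∈ T2, m a b = 0 := by
      intro a ha b hb
      simp only [hT1, hT2, Finset.mem_filter] at ha hb
      by_contra hne
      exact hb.2 (hA a ha.1 ha.2 b hb.1 (Nat.pos_of_ne_zero hne))
    have no1 : ∀ a ∈ T1, ∀ b ∈ T, b ∉ T1 → m a b = 0 := by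
      intro a ha b hb hb1
      rw [hu12] at hb
      exact hz12 a ha b ((Finset.mem_union.mp hb).resolve_left hb1)
    have no2 : ∀ a ∈ T2, ∀ b ∈ T, b ∉ T2 → m a b = 0 := by
      intro a ha b hb hb1
      rw [hu12] at hb
      rw [hs]
      exact hz12 b ((Finset.mem_union.mp hb).resolve_right hb1) a ha
    have n1 : T1.Nonempty := ⟨z, by simp [hT1, hzT, hzA]⟩
    have n2 : T2.Nonempty := ⟨y, by simp [hT2, hyT, hyA]⟩
    obtain ⟨b1, hb1, hvb1⟩ := hpiece T1 s1 n1 no1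
    obtain ⟨b2, hb2, hvb2⟩ := hpiece T2 s2 n2 no2
    have p1 : 1 ≤ ee m {v} T1 := ee_pos (Finset.mem_singleton_self v) hb1 hvb1
    have p2 : 1 ≤ ee m {v} T2 := ee_pos (Finset.mem_singleton_self v) hb2 hvb2
    have hvTs : ee m {v} T = ee m {v} T1 + ee m {v} T2 := by
      rw [hu12, ee_union_right _ _ _ _ hd12]
    have q1 : ee m {v} T1 = 1 := by omega
    have q2 : ee m {v} T2 = 1 := by omega
    have hconn : ∀ X ⊆ T, (∀ a ∈ X, ∀ b ∈ T, b ∉ X → m a b = 0) → ee m {v} X = 1 →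
        Conn (fun a b => 0 < m a b) X := by
      intro X hX h0 hX1
      by_contra hcX
      unfold Conn at hcX
      push Not at hcX
      obtain ⟨A, hA, z, hzX, hzA, y, hyX, hyA⟩ := hcX
      have hz12 : ∀ a ∈ X, a ∈ A → ∀ b ∈ X, b ∉ A → m a b = 0 := by
        intro a ha haA b hb hbA
        by_contra hne
        exact hbA (hA a ha haA b hb (Nat.pos_of_ne_zero hne))
      obtain ⟨c1, hc1, hvc1⟩ := hpiece (X.filter (fun a => a ∈ A))
        ((Finset.filter_subset _ _).trans hX) ⟨z, by simp [hzX, hzA]⟩ (by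
          intro a ha b hb hbn
          simp only [Finset.mem_filter] at ha hbn
          by_cases hbX : b ∈ X
          · exact hz12 a ha.1 ha.2 b hbX (fun h => hbn ⟨hbX, h⟩)
          · exact h0 a ha.1 b hb hbX)
      obtain ⟨c2, hc2, hvc2⟩ := hpiece (X.filter (fun a => a ∉ A))
        ((Finset.filter_subset _ _).trans hX) ⟨y, by simp [hyX, hyA]⟩ (by
          intro a ha b hb hbn
          simp only [Finset.mem_filter] at ha hbn
          by_cases hbX : b ∈ X
          · rw [hs]
            exact hz12 b hbX (by by_contra h; exact hbn ⟨hbX, h⟩) a ha.1 ha.2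
          · exact h0 a ha.1 b hb hbX)
      have r1 := ee_pos (Finset.mem_singleton_self v) hc1 hvc1
      have r2 := ee_pos (Finset.mem_singleton_self v) hc2 hvc2
      have r3 : ee m {v} X = ee m {v} (X.filter (fun a => a ∈ A)) +
          ee m {v} (X.filter (fun a => a ∉ A)) := by
        rw [← ee_union_right _ _ _ _ (Finset.disjoint_filter_filter_not _ _ _),
          Finset.filter_union_filter_not_eq]
      omega
    have hcard : T.card = T1.card + T2.card := by
      rw [hu12, Finset.card_union_of_disjoint hd12]
    have k1 : 1 ≤ T1.card := n1.card_pos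
    have k2 : 1 ≤ T2.card := n2.card_pos
    obtain ⟨F1, f11, f12, f13⟩ := IH T1.card (by omega) T1 b1 rfl hb1 (hconn T1 s1 no1 q1)
      ⟨v, fun h => hvT (s1 h), by rwa [hs]⟩
    obtain ⟨F2, f21, f22, f23⟩ := IH T2.card (by omega) T2 b2 rfl hb2 (hconn T2 s2 no2 q2)
      ⟨v, fun h => hvT (s2 h), by rwa [hs]⟩
    have c1 := hXX T1 s1 no1
    have c2 := hXX T2 s2 no2
    have c3 : ee m T Sᶜ = ee m T1 Sᶜ + ee m T2 Sᶜ := by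
      rw [hu12, ee_union_left _ _ _ _ hd12]
    refine ⟨insert (v, b1) (insert (v, b2) (F1 ∪ F2)), ?_, ?_, fun σ hσ => ?_⟩
    · intro e he
      simp only [Finset.mem_insert, Finset.mem_union] at he
      rcases he with rfl | rfl | he | he
      · exact le_antisymm ((ee_le (m := m) (Finset.mem_singleton_self v) hb1).trans q1.le) hvb1
      · exact le_antisymm ((ee_le (m := m) (Finset.mem_singleton_self v) hb2).trans q2.le) hvb2
      · exact f11 e he
      · exact f21 e he
    · have g1 := Finset.card_insert_le (v, b1) (insert (v, b2) (F1 ∪ F2))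
      have g2 := Finset.card_insert_le (v, b2) (F1 ∪ F2)
      have g3 := Finset.card_union_le F1 F2
      omega
    · have hins : S = insert v T1 ∪ insert v T2 := by
        rw [hST, hu12]; ext a; simp
      rw [hins]
      refine Conn.union (v := v) ?_ ?_ (Finset.mem_insert_self _ _) (Finset.mem_insert_self _ _)
      · refine ((f13 σ hσ).mono (MRel.mono ?_)).insert (MRel.symm hs hσ) hb1 ?_
        · intro e he; simp [he]
        · exact Or.inr (Or.inr (Or.inl (by simp)))
      · refine ((f23 σ hσ).mono (MRel.mono ?_)).insert (MRel.symm hs hσ) hb2 ?_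
        · intro e he; simp [he]
        · exact Or.inr (Or.inr (Or.inl (by simp)))

theorem struct_top {V : Type} [Fintype V] [DecidableEq V] [Nonempty V] {m : V → V → ℕ}
    (hs : ∀ u v, m u v = m v u) (hd : ∀ u, m u u = 0) (h3 : ∀ u, ∑ v, m u v = 3)
    (hb : ∀ S : Finset V, S.Nonempty → S ≠ Finset.univ → 2 ≤ ee m S Sᶜ) :
    ∃ F : Finset (V × V), (∀ e ∈ F, m e.1 e.2 = 1) ∧ 2 * F.card + 2 ≤ Fintype.card V ∧
        ∀ σ : V → V, (∀ v, σ (σ v) = v) → Conn (MRel m σ F) Finset.univ := by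
  classical
  obtain ⟨u⟩ := ‹Nonempty V›
  set S : Finset V := {u}ᶜ with hS
  have huS : u ∉ S := by simp [hS]
  have hSc : Sᶜ = {u} := by simp [hS]
  have huS3 : ee m {u} S = 3 := by
    have : ee m {u} {u} + ee m {u} S = 3 := by
      rw [hS, ← ee_union_right _ _ _ _ disjoint_compl_right, Finset.union_compl]
      simp [ee, h3]
    have h0 : ee m {u} {u} = 0 := by simp [ee, hd]
    omega
  have hcard : S.card + 1 = Fintype.card V := by
    rw [← Finset.card_add_card_compl S, hSc]; simp
  obtain ⟨v, hv, huv⟩ : ∃ v ∈ S, 0 < m u v := by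
    by_contra! hcon
    have : ee m {u} S = 0 := ee_zero (by
      intro a ha b hb
      rw [Finset.mem_singleton] at ha
      subst ha
      have := hcon b hb
      omega)
    omega
  have hc : Conn (fun a b => 0 < m a b) S := by
    by_contra hcX
    unfold Conn at hcX
    push Not at hcX
    obtain ⟨A, hA, z, hzX, hzA, y, hyX, hyA⟩ := hcX
    have hz12 : ∀ a ∈ S, a ∈ A → ∀ b ∈ S, b ∉ A → m a b = 0 := by
      intro a ha haA b hb hbA
      by_contra hne
      exact hbA (hA a ha haA b hb (Nat.pos_of_ne_zero hne))
    have key : ∀ X ⊆ S, X.Nonempty → (∀ a ∈ X, ∀ b ∈ S, b ∉ X → m a b = 0) →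
        2 ≤ ee m {u} X := by
      intro X hX hne h0
      have h1 := hb X hne (by rintro rfl; exact huS (hX (Finset.mem_univ u)))
      have e : Xᶜ = {u} ∪ (S \ X) := by
        ext a
        have h1 : a ∈ X → a ∈ S := fun h => hX h
        have h2 : a ∈ S ↔ a ≠ u := by simp [hS]
        simp only [Finset.mem_compl, Finset.mem_union, Finset.mem_singleton, Finset.mem_sdiff]
        tauto
      have d1 : Disjoint {u} (S \ X) := by simp [huS]
      rw [e, ee_union_right _ _ _ _ d1, ee_zero (A := X) (B := S \ X), ee_symm hs X {u},
        add_zero] at h1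
      · exact h1
      · intro a ha b hb
        exact h0 a ha b (Finset.mem_sdiff.mp hb).1 (Finset.mem_sdiff.mp hb).2
    have r1 := key (S.filter (fun a => a ∈ A))
      (Finset.filter_subset _ _) ⟨z, by simp [hzX, hzA]⟩ (by
        intro a ha b hb hbn
        simp only [Finset.mem_filter] at ha hbn
        exact hz12 a ha.1 ha.2 b hb (fun h => hbn ⟨hb, h⟩))
    have r2 := key (S.filter (fun a => a ∉ A))
      (Finset.filter_subset _ _) ⟨y, by simp [hyX, hyA]⟩ (by
        intro a ha b hb hbn
        simp only [Finset.mem_filter] at ha hbn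
        rw [hs]
        exact hz12 b hb (by by_contra h; exact hbn ⟨hb, h⟩) a ha.1 ha.2)
    have r3 : ee m {u} S = ee m {u} (S.filter (fun a => a ∈ A)) +
        ee m {u} (S.filter (fun a => a ∉ A)) := by
      rw [← ee_union_right _ _ _ _ (Finset.disjoint_filter_filter_not _ _ _),
        Finset.filter_union_filter_not_eq]
    omega
  obtain ⟨F, f1, f2, f3⟩ := struct hs hd h3 _ S v rfl hv hc ⟨u, huS, by rwa [hs]⟩
  refine ⟨F, f1, ?_, fun σ hσ => ?_⟩
  · rw [hSc, ee_symm hs, huS3] at f2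
    omega
  · obtain ⟨b, hb1, hb2⟩ := MRel.exists (m := m) σ F u S (by omega)
    have := (f3 σ hσ).insert (MRel.symm hs hσ) hb1 hb2
    have e : insert u S = Finset.univ := by
      ext a; by_cases h : a = u <;> simp [hS, h]
    rwa [e] at this

/-- Multiplicity matrix of the multigraph. -/
noncomputable def mult {V ι : Type} [Fintype ι] (ε : ι → Sym2 V) (u v : V) : ℕ := by
  classical exact (Finset.univ.filter fun i => ε i = s(u, v)).card

theorem mult_symm {V ι : Type} [Fintype ι] (ε : ι → Sym2 V) (u v : V) :
    mult ε u v = mult ε v u := by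
  unfold mult; rw [Sym2.eq_swap]

theorem mult_diag {V ι : Type} [Fintype ι] (ε : ι → Sym2 V) (hl : ∀ i, ¬ (ε i).IsDiag) (u : V) :
    mult ε u u = 0 := by
  classical
  unfold mult
  rw [Finset.card_eq_zero, Finset.filter_eq_empty_iff]
  intro i _ h
  apply hl i
  rw [h]
  simp

theorem mult_row {V ι : Type} [Fintype V] [Fintype ι] (ε : ι → Sym2 V) (u : V) :
    ∑ v, mult ε u v = mgDegree ε u := by
  classical
  unfold mult mgDegree
  rw [← Finset.card_biUnion]
  · congr 1
    ext i
    simp only [Finset.mem_biUnion, Finset.mem_univ, true_and, Finset.mem_filter]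
    rw [Sym2.mem_iff_exists]
  · intro a _ b _ hab
    rw [Function.onFun, Finset.disjoint_left]
    intro i h1 h2
    simp only [Finset.mem_filter, Finset.mem_univ, true_and] at h1 h2
    rw [h1] at h2
    exact hab (Sym2.congr_right.mp h2)

theorem mult_cut {V ι : Type} [Fintype V] [DecidableEq V] [Fintype ι] (ε : ι → Sym2 V)
    (S : Finset V) : ee (mult ε) S Sᶜ = (mgCut ε S).card := by
  classical
  unfold ee mult mgCut
  rw [← Finset.sum_product', ← Finset.card_biUnion]
  · congr 1
    ext i
    simp only [Finset.mem_biUnion, Finset.mem_univ, true_and, Finset.mem_filter,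
      Finset.mem_product, Finset.mem_compl]
    constructor
    · rintro ⟨⟨a, b⟩, ⟨ha, hb⟩, h⟩
      exact ⟨a, ha, b, hb, h⟩
    · rintro ⟨a, ha, b, hb, h⟩
      exact ⟨⟨a, b⟩, ⟨ha, hb⟩, h⟩
  · rintro ⟨a, b⟩ h ⟨a', b'⟩ h' hab
    rw [Function.onFun, Finset.disjoint_left]
    intro i h1 h2
    simp only [Finset.mem_filter, Finset.mem_univ, true_and] at h1 h2
    simp only [Finset.coe_product, Set.mem_prod, Finset.mem_coe, Finset.mem_compl] at h h'
    rw [h1] at h2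
    rcases Sym2.eq_iff.mp h2 with ⟨rfl, rfl⟩ | ⟨rfl, rfl⟩
    · exact hab rfl
    · exact h.2 h'.1

theorem mult_inP {V : Type} [Fintype V] [DecidableEq V] {m : V → V → ℕ}
    (hs : ∀ u v, m u v = m v u) (hd : ∀ u, m u u = 0) (h3 : ∀ u, ∑ v, m u v = 3)
    (hb : ∀ S : Finset V, S.Nonempty → S ≠ Finset.univ → 2 ≤ ee m S Sᶜ) :
    InP (fun u v => (m u v : ℝ) / 3) := by
  have hsplit : ∀ S : Finset V, 3 * S.card = ee m S S + ee m S Sᶜ := by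
    intro S
    rw [← ee_union_right _ _ _ _ disjoint_compl_right, Finset.union_compl]
    simp [ee, h3, mul_comm]
  have heven : ∀ S : Finset V, Even (ee m S S) := by
    intro S
    induction S using Finset.induction_on with
    | empty => simp [ee]
    | insert a S ha ih =>
      have hdj : Disjoint {a} S := by simpa using ha
      have h0 : ee m {a} {a} = 0 := by simp [ee, hd]
      have : ee m (insert a S) (insert a S) = ee m S S + 2 * ee m {a} S := by
        rw [Finset.insert_eq, ee_union_left _ _ _ _ hdj, ee_union_right _ _ _ _ hdj,
          ee_union_right _ _ _ _ hdj, ee_symm hs S {a}, h0]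
        ring
      rw [this]
      exact ih.add (even_two_mul _)
  refine ⟨fun u v => by positivity, fun u v => by rw [hs], fun u => by simp [hd], fun u => ?_, ?_⟩
  · rw [← Finset.sum_div, ← Nat.cast_sum, h3]; norm_num
  · intro S hS
    have hcut : 3 ≤ ee m S Sᶜ := by
      have h1 := hsplit S
      obtain ⟨c, hc⟩ := heven S
      obtain ⟨d, hd⟩ := hS
      have hne : S.Nonempty := by
        rw [← Finset.card_pos]; omega
      have hnu : S ≠ Finset.univ := by
        rintro rfl
        have : ee m Finset.univ (Finset.univ : Finset V)ᶜ = 0 := by simp [ee]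
        omega
      have := hb S hne hnu
      omega
    have h2 : (3 : ℝ) ≤ (ee m S Sᶜ : ℝ) := by exact_mod_cast hcut
    simp only [← Finset.sum_div]
    have h4 : (ee m S Sᶜ : ℝ) = ∑ a ∈ S, ∑ b ∈ Sᶜ, (m a b : ℝ) := by
      unfold ee; push_cast; rfl
    rw [← h4]
    linarith

theorem comp_count {V : Type} [Fintype V] [Nonempty V] (G : SimpleGraph V)
    (E : Finset (Sym2 V))
    (hc : Conn (fun a b => G.Adj a b ∨ s(a, b) ∈ E) (Finset.univ : Finset V)) :
    Nat.card G.ConnectedComponent ≤ E.card + 1 := by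
  classical
  let q : V → G.ConnectedComponent := G.connectedComponentMk
  let H : SimpleGraph G.ConnectedComponent :=
    SimpleGraph.fromEdgeSet ((E.image (Sym2.map q) : Finset _) : Set (Sym2 G.ConnectedComponent))
  have hH : H.Connected := by
    obtain ⟨v0⟩ := ‹Nonempty V›
    have : Nonempty G.ConnectedComponent := ⟨q v0⟩
    have key : ∀ u v, H.Reachable (q u) (q v) := by
      intro u v
      refine hc {v | H.Reachable (q u) (q v)} ?_ u (Finset.mem_univ _)
        (SimpleGraph.Reachable.refl _) v (Finset.mem_univ _)
      intro a _ ha b _ hab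
      simp only [Set.mem_ofPred_eq] at ha ⊢
      by_cases hq : q a = q b
      · rwa [← hq]
      refine ha.trans (SimpleGraph.Adj.reachable ?_)
      rcases hab with h | h
      · exact absurd (SimpleGraph.ConnectedComponent.sound h.reachable) hq
      · rw [SimpleGraph.fromEdgeSet_adj]
        refine ⟨?_, hq⟩
        rw [Finset.mem_coe, Finset.mem_image]
        exact ⟨_, h, by simp⟩
    refine ⟨fun c d => ?_⟩
    induction c using SimpleGraph.ConnectedComponent.ind with | _ u => ?_
    induction d using SimpleGraph.ConnectedComponent.ind with | _ v => ?_
    exact key u v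
  refine hH.card_vert_le_card_edgeSet_add_one.trans ?_
  have h1 : Nat.card H.edgeSet ≤ (E.image (Sym2.map q)).card := by
    rw [Nat.card_coe_set_eq, ← Set.ncard_coe_finset]
    apply Set.ncard_le_ncard
    · rw [SimpleGraph.edgeSet_fromEdgeSet]
      exact Set.sdiff_subset
    · exact Finset.finite_toSet _
  have h2 : (E.image (Sym2.map q)).card ≤ E.card := Finset.card_image_le
  omega

/-- Every bridgeless cubic multigraph on `n` vertices has a cycle cover
(a spanning 2-regular sub-multigraph) with at most `⌊n/6 + 2/3⌋ = (n + 4)/6` cycles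
(cycles = connected components of the cover; a pair of parallel edges is a 2-cycle). -/
theorem stmt14 {V ι : Type} [Fintype V] [Fintype ι] [DecidableEq ι]
    (ε : ι → Sym2 V) (hloopless : ∀ i, ¬ (ε i).IsDiag)
    (hcubic : ∀ v : V, mgDegree ε v = 3)
    (hbridgeless : ∀ S : Finset V, S.Nonempty → S ≠ Finset.univ → 2 ≤ (mgCut ε S).card)
    (n : ℕ) (hn : n = Fintype.card V) :
    ∃ C : Finset ι, (∀ v : V, mgDegree (fun i : {i // i ∈ C} => ε i.1) v = 2) ∧
      Nat.card (SimpleGraph.fromEdgeSet {e | ∃ i ∈ C, ε i = e} :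
        SimpleGraph V).ConnectedComponent ≤ (n + 4) / 6 := by
  classical
  subst hn
  rcases isEmpty_or_nonempty V with hV | hV
  · refine ⟨∅, fun v => hV.elim v, ?_⟩
    have : IsEmpty (SimpleGraph.fromEdgeSet {e | ∃ i ∈ (∅ : Finset ι), ε i = e} :
        SimpleGraph V).ConnectedComponent := ⟨fun c => by
      induction c using SimpleGraph.ConnectedComponent.ind with | _ v => exact hV.elim v⟩
    rw [Nat.card_of_isEmpty]
    exact Nat.zero_le _
  obtain ⟨m, hm⟩ : ∃ m, m = mult ε := ⟨_, rfl⟩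
  have hs : ∀ u v, m u v = m v u := by rw [hm]; exact mult_symm ε
  have hd : ∀ u, m u u = 0 := by rw [hm]; exact mult_diag ε hloopless
  have h3 : ∀ u, ∑ v, m u v = 3 := by
    rw [hm]; exact fun u => (mult_row ε u).trans (hcubic u)
  have hb : ∀ S : Finset V, S.Nonempty → S ≠ Finset.univ → 2 ≤ ee m S Sᶜ := by
    intro S h1 h2
    rw [hm, mult_cut]
    exact hbridgeless S h1 h2
  obtain ⟨F, f1, f2, f3⟩ := struct_top hs hd h3 hb
  obtain ⟨σ, hσ, hle⟩ := edmonds V _ (fun u v => if (u, v) ∈ F then 1 else 0)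
    (mult_inP hs hd h3 hb)
  have hconn := f3 σ hσ.inv
  set P := Finset.univ.filter (fun v => (v, σ v) ∈ F) with hP
  have hPF : 3 * P.card ≤ F.card := by
    have l1 : ∑ v, (if (v, σ v) ∈ F then (1 : ℝ) else 0) = P.card := by
      rw [Finset.sum_boole]
    have l2 : ∑ u, ∑ v, (if (u, v) ∈ F then (1 : ℝ) else 0) * ((m u v : ℝ) / 3)
        ≤ F.card / 3 := by
      rw [← Finset.sum_product', Finset.univ_product_univ]
      simp only [ite_mul, one_mul, zero_mul]
      rw [← Finset.sum_filter]
      have : (Finset.univ.filter fun e : V × V => (e.1, e.2) ∈ F) = F := by ext; simp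
      rw [this]
      calc ∑ e ∈ F, (m e.1 e.2 : ℝ) / 3 ≤ ∑ e ∈ F, (1 : ℝ) / 3 := by
            refine Finset.sum_le_sum fun e he => ?_
            have : (m e.1 e.2 : ℝ) ≤ 1 := by exact_mod_cast (f1 e he).le
            linarith
        _ = F.card / 3 := by simp; ring
    rw [l1] at hle
    have l3 := hle.trans l2
    have : (3 * P.card : ℝ) ≤ F.card := by linarith
    exact_mod_cast this
  -- choose matching edges
  have hex : ∀ v, ∃ i, ε i = s(v, σ v) := by
    intro v
    have h1 := hσ.pos v
    have h2 : 0 < m v (σ v) := by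
      by_contra h
      have : m v (σ v) = 0 := by omega
      rw [this] at h1
      simp at h1
    rw [hm, mult, Finset.card_pos] at h2
    obtain ⟨i, hi⟩ := h2
    exact ⟨i, (Finset.mem_filter.mp hi).2⟩
  let g : Sym2 V → ι := fun e => if h : ∃ i, ε i = e then h.choose else (hex hV.some).choose
  have hg : ∀ v, ε (g s(v, σ v)) = s(v, σ v) := by
    intro v
    have : g s(v, σ v) = (hex v).choose := dif_pos (hex v)
    rw [this]
    exact (hex v).choose_spec
  let M : Finset ι := Finset.univ.image fun v => g s(v, σ v)
  have hM : ∀ i ∈ M, ∀ v, v ∈ ε i → i = g s(v, σ v) := by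
    intro i hi v hv
    obtain ⟨u, _, rfl⟩ := Finset.mem_image.mp hi
    simp only [hg] at hv
    rcases Sym2.mem_iff.mp hv with rfl | rfl
    · rfl
    · simp only [hσ.inv]
      rw [Sym2.eq_swap]
  refine ⟨Mᶜ, fun v => ?_, ?_⟩
  · have h1 := hcubic v
    unfold mgDegree at h1 ⊢
    have h2 : (Finset.univ.filter fun i => v ∈ ε i) =
        insert (g s(v, σ v)) (Finset.univ.filter fun i => v ∈ ε i ∧ i ∈ Mᶜ) := by
      ext i
      simp only [Finset.mem_filter, Finset.mem_univ, true_and, Finset.mem_insert,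
        Finset.mem_compl]
      constructor
      · intro hi
        by_cases hiM : i ∈ M
        · exact Or.inl (hM i hiM v hi)
        · exact Or.inr ⟨hi, hiM⟩
      · rintro (rfl | h)
        · rw [hg]; simp
        · exact h.1
    have h4 : g s(v, σ v) ∉ (Finset.univ.filter fun i => v ∈ ε i ∧ i ∈ Mᶜ) := by
      simp [M]
    rw [h2, Finset.card_insert_of_notMem h4] at h1
    have h5 : (Finset.univ.filter fun i : {i // i ∈ Mᶜ} => v ∈ ε i.1).card =
        (Finset.univ.filter fun i => v ∈ ε i ∧ i ∈ Mᶜ).card := by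
      refine Finset.card_bij (fun i _ => i.1) ?_ ?_ ?_
      · intro i hi
        simp only [Finset.mem_filter, Finset.mem_univ, true_and] at hi ⊢
        exact ⟨hi, i.2⟩
      · intro i _ j _ h
        exact Subtype.ext h
      · intro i hi
        simp only [Finset.mem_filter, Finset.mem_univ, true_and] at hi
        exact ⟨⟨i, hi.2⟩, by simp [hi.1], rfl⟩
    have h6 : (Finset.univ.filter fun i : {i // i ∈ Mᶜ} => v ∈ ε i.1).card = 2 := by omega
    convert h6
  · have hcc := comp_count (SimpleGraph.fromEdgeSet {e | ∃ i ∈ Mᶜ, ε i = e})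
      (P.image fun v => s(v, σ v)) ?_
    · have : (P.image fun v => s(v, σ v)).card ≤ P.card := Finset.card_image_le
      omega
    · -- a pair joined by an edge of index `i ∉ M`
      have hadj : ∀ a b i, i ∉ M → ε i = s(a, b) →
          (SimpleGraph.fromEdgeSet {e | ∃ i ∈ Mᶜ, ε i = e}).Adj a b := by
        intro a b i hi he
        rw [SimpleGraph.fromEdgeSet_adj]
        refine ⟨⟨i, Finset.mem_compl.mpr hi, he⟩, ?_⟩
        rintro rfl
        apply hloopless i
        rw [he]; simp
      -- edges of positive multiplicity: either kept, or matching edges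
      have hgen : ∀ a b, 0 < m a b → σ a ≠ b →
          (SimpleGraph.fromEdgeSet {e | ∃ i ∈ Mᶜ, ε i = e}).Adj a b := by
        intro a b hpos hab
        rw [hm, mult, Finset.card_pos] at hpos
        obtain ⟨i, hi⟩ := hpos
        have hi := (Finset.mem_filter.mp hi).2
        refine hadj a b i (fun hiM => hab ?_) hi
        have h1 := hM i hiM a (by rw [hi]; simp)
        rw [h1, hg] at hi
        exact Sym2.congr_right.mp hi
      have hFE : ∀ a b, (a, b) ∈ F → σ a = b → s(a, b) ∈ P.image fun v => s(v, σ v) := by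
        rintro a b hF rfl
        exact Finset.mem_image_of_mem (fun v => s(v, σ v)) (by simp [hP, hF])
      refine hconn.mono fun a b hab => ?_
      rcases hab with h | h | h | h
      · left
        by_cases hab : σ a = b
        · rw [hm, mult] at h
          obtain ⟨i, hi, hne⟩ := Finset.exists_mem_ne (Nat.lt_of_succ_le h) (g s(a, σ a))
          have hi := (Finset.mem_filter.mp hi).2
          exact hadj a b i (fun hiM => hne (hM i hiM a (by rw [hi]; simp))) hi
        · exact hgen a b (by omega) hab
      · exact Or.inl (hgen a b (by omega) h.2)
      · by_cases hab : σ a = b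
        · exact Or.inr (hFE a b h hab)
        · have := f1 _ h
          exact Or.inl (hgen a b (by simp only at this; omega) hab)
      · by_cases hab : σ b = a
        · right
          rw [Sym2.eq_swap]
          exact hFE b a h hab
        · have := f1 _ h
          exact Or.inl (hgen b a (by simp only at this; omega) hab).symm
end
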